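/- arXiv:1803.10798 — 2 statements merged into one kernel-verified Lean document; each statement's English description precedes it below -/
import Mathlib

section
/- There exists Y > 0 such that for all σ, τ in the upper half-plane with Im σ > Y and Im τ > Y, the infinite product converges absolutely and p^{-1} · ∏_{d=1}^∞ ∏_{r=0}^∞ (1 − p^d q^r)^{C_{0,0}(rd)} · (1 + p^d q^r)^{C_{0,1}(rd)} = η(σ)^{24}/η(2σ)^{24} + 24 − f_R(τ). (This is the denominator identity of the Conway Borcherds–Kac–Moody superalgebra.) -/
open scoped Real

/-- The Dedekind eta function `η(τ) = e^{πiτ/12} ∏_{n=1}^∞ (1 - e^{2πinτ})`. -/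
noncomputable def eta (τ : ℂ) : ℂ :=
  Complex.exp (Real.pi * Complex.I * τ / 12) *
    ∏' n : ℕ, (1 - Complex.exp (2 * Real.pi * Complex.I * (n + 1) * τ))

/-- `f_NS(τ) = η(τ)^48/(η(τ/2)^24 η(2τ)^24) − 24`. -/
noncomputable def fNS (τ : ℂ) : ℂ :=
  eta τ ^ 48 / (eta (τ / 2) ^ 24 * eta (2 * τ) ^ 24) - 24

/-- `f̃_NS(τ) = η(τ/2)^24/η(τ)^24 + 24`. -/
noncomputable def ftNS (τ : ℂ) : ℂ :=
  eta (τ / 2) ^ 24 / eta τ ^ 24 + 24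

/-- `f_R(τ) = 2^12 η(2τ)^24/η(τ)^24 + 24`. -/
noncomputable def fR (τ : ℂ) : ℂ :=
  2 ^ 12 * eta (2 * τ) ^ 24 / eta τ ^ 24 + 24

namespace Conway
open Complex Filter Topology

abbrev Mat := Matrix (Fin 2) (Fin 2) ℤ

noncomputable def mob (M : Mat) (z : ℂ) : ℂ :=
  ((M 0 0 : ℂ) * z + (M 0 1 : ℂ)) / ((M 1 0 : ℂ) * z + (M 1 1 : ℂ))

lemma denom_ne (c d : ℤ) (h : c ≠ 0 ∨ d ≠ 0) {z : ℂ} (hz : 0 < z.im) : (c : ℂ) * z + d ≠ 0 := by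
  intro h0
  have h1 := congrArg Complex.im h0
  have h2 := congrArg Complex.re h0
  simp at h1 h2
  rcases h1 with h1 | h1
  · subst h1
    simp at h2
    simp [h2] at h
  · exact hz.ne' h1

lemma mat_row (M : Mat) (h : 0 < M.det) : M 1 0 ≠ 0 ∨ M 1 1 ≠ 0 := by
  by_contra! hc
  rw [Matrix.det_fin_two, hc.1, hc.2] at h
  simp at h

lemma mob_denom_ne (M : Mat) (h : 0 < M.det) {z : ℂ} (hz : 0 < z.im) :
    (M 1 0 : ℂ) * z + (M 1 1 : ℂ) ≠ 0 := denom_ne _ _ (mat_row M h) hz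

lemma mob_im (M : Mat) (z : ℂ) :
    (mob M z).im = M.det * z.im / Complex.normSq ((M 1 0 : ℂ) * z + (M 1 1 : ℂ)) := by
  rw [mob, Complex.div_im, Matrix.det_fin_two]
  simp
  ring

lemma mob_im_pos (M : Mat) (h : 0 < M.det) {z : ℂ} (hz : 0 < z.im) : 0 < (mob M z).im := by
  rw [mob_im]
  have : (0:ℝ) < M.det := by exact_mod_cast h
  have := Complex.normSq_pos.mpr (mob_denom_ne M h hz)
  positivity

lemma mob_aux (a b c d a' b' c' d' z : ℂ) (h1 : c' * z + d' ≠ 0)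
    (h3 : (c * a' + d * c') * z + (c * b' + d * d') ≠ 0) :
    ((a * a' + b * c') * z + (a * b' + b * d')) / ((c * a' + d * c') * z + (c * b' + d * d')) =
    (a * ((a' * z + b') / (c' * z + d')) + b) / (c * ((a' * z + b') / (c' * z + d')) + d) := by
  have e1 : (a * ((a' * z + b') / (c' * z + d')) + b) =
    ((a * a' + b * c') * z + (a * b' + b * d')) / (c' * z + d') := by
    rw [eq_div_iff h1, add_mul, mul_assoc, div_mul_cancel₀ _ h1]; ring
  have e2 : (c * ((a' * z + b') / (c' * z + d')) + d) =
    ((c * a' + d * c') * z + (c * b' + d * d')) / (c' * z + d') := by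
    rw [eq_div_iff h1, add_mul, mul_assoc, div_mul_cancel₀ _ h1]; ring
  rw [e1, e2, div_div_div_cancel_right₀ h1]

lemma mob_mul (M N : Mat) (hM : 0 < M.det) (hN : 0 < N.det) {z : ℂ} (hz : 0 < z.im) :
    mob (M * N) z = mob M (mob N z) := by
  have h1 := mob_denom_ne N hN hz
  have h3 := mob_denom_ne (M * N) (by rw [Matrix.det_mul]; positivity) hz
  simp only [mob, Matrix.mul_apply, Fin.sum_univ_two] at *
  push_cast at *
  exact mob_aux _ _ _ _ _ _ _ _ z h1 h3

lemma W_im_pos {z : ℂ} (hz : 0 < z.im) : 0 < (-1 / (2 * z)).im := by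
  have := mob_im_pos !![0, -1; 2, 0] (by simp [Matrix.det_fin_two]) hz
  simpa [mob] using this

structure IsG0 (g : Mat) : Prop where
  det : g.det = 1
  ev : Even (g 1 0)

open UpperHalfPlane ModularForm CongruenceSubgroup MatrixGroups in
lemma sl_smul (g : SL(2, ℤ)) (τ : ℍ) : ((g • τ : ℍ) : ℂ) = mob g.1 τ := by
  rw [UpperHalfPlane.specialLinearGroup_apply]
  simp [mob]

open UpperHalfPlane ModularForm CongruenceSubgroup MatrixGroups in
lemma liouville (G : ℂ → ℂ) (hd : DifferentiableOn ℂ G {z | 0 < z.im})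
    (hinv : ∀ g : Mat, IsG0 g → ∀ z : ℂ, 0 < z.im → G (mob g z) = G z)
    (B Y : ℝ) (h1 : ∀ z : ℂ, Y < z.im → ‖G z‖ ≤ B)
    (h2 : ∀ z : ℂ, 0 < z.im → Y < z.im → ‖G (-1 / (2 * z))‖ ≤ B) :
    ∃ c, ∀ z : ℂ, 0 < z.im → G z = c := by
  let f : ModularForm ((Gamma0 2 : Subgroup SL(2, ℤ)) : Subgroup (GL (Fin 2) ℝ)) 0 :=
  { toFun := fun τ => G τ
    slash_action_eq' := by
      intro γ hγ
      obtain ⟨g, hg, rfl⟩ := hγ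
      have hg' : Even (g.1 1 0) := by
        have := Gamma0_mem.mp hg
        rw [ZMod.intCast_zmod_eq_zero_iff_dvd] at this
        exact even_iff_two_dvd.mpr (by exact_mod_cast this)
      have : ((fun τ : ℍ => G τ) ∣[(0:ℤ)] g) = fun τ : ℍ => G τ := by
        ext τ
        rw [SL_slash_apply]
        simp only [sl_smul, hinv g.1 ⟨g.2, hg'⟩ τ τ.2, neg_zero, zpow_zero, mul_one]
      exact this
    holo' := by
      rw [UpperHalfPlane.mdifferentiable_iff]
      refine hd.congr fun z hz ↦ ?_
      simp [ofComplex_apply_of_im_pos hz]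
    bdd_at_cusps' := by
      intro c hc
      rw [Subgroup.IsArithmetic.isCusp_iff_isCusp_SL2Z] at hc
      rw [OnePoint.isBoundedAt_iff_forall_SL2Z hc]
      intro g _
      rw [UpperHalfPlane.isBoundedAtImInfty_iff]
      have hdet : g.1 0 0 * g.1 1 1 - g.1 0 1 * g.1 1 0 = 1 := by
        rw [← Matrix.det_fin_two]; exact g.2
      by_cases hev : Even (g.1 1 0)
      · refine ⟨B, Y + 1, fun τ hτ => ?_⟩
        rw [SL_slash_apply]
        simp only [sl_smul, hinv g.1 ⟨g.2, hev⟩ τ τ.2, neg_zero, zpow_zero, mul_one]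
        exact h1 _ (by have : (τ : ℂ).im = τ.im := rfl
                       linarith)
      · -- g = g' * !![0,-1;1,j]
        obtain ⟨j, hj⟩ : ∃ j : ℤ, Even (g.1 1 1 - j * g.1 1 0) := by
          refine ⟨g.1 1 1, ?_⟩
          have : Odd (g.1 1 0) := Int.not_even_iff_odd.mp hev
          obtain ⟨t, ht⟩ := this
          exact ⟨-t * g.1 1 1, by rw [ht]; ring⟩
        let g' : Mat := !![g.1 0 0 * j - g.1 0 1, g.1 0 0; g.1 1 0 * j - g.1 1 1, g.1 1 0]
        have hg' : IsG0 g' := ⟨by simp [g', Matrix.det_fin_two]; linarith, by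
          simp [g']; rw [← even_neg]
          have e : -(g.1 1 0 * j - g.1 1 1) = g.1 1 1 - j * g.1 1 0 := by ring
          exact e ▸ hj⟩
        have hmul : g.1 = g' * !![0, -1; 1, j] := by
          ext a b
          fin_cases a <;> fin_cases b <;> simp [g', Matrix.mul_apply] <;> ring
        refine ⟨B, 2 * |Y| + 1, fun τ hτ => ?_⟩
        rw [SL_slash_apply]
        have hdd : (0 : ℤ) < (!![0, -1; 1, j] : Mat).det := by simp [Matrix.det_fin_two]
        have e : mob (!![0, -1; 1, j] : Mat) τ = -1 / (2 * (((τ : ℂ) + j) / 2)) := by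
          simp [mob]
          congr 1; ring
        simp only [sl_smul, neg_zero, zpow_zero, mul_one]
        rw [hmul, mob_mul _ _ (by rw [hg'.det]; norm_num) hdd τ.2,
          hinv g' hg' _ (mob_im_pos _ hdd τ.2), e]
        have him : (((τ : ℂ) + j) / 2).im = τ.im / 2 := by simp
        have := le_abs_self Y
        exact h2 _ (by rw [him]; have := τ.2; positivity) (by rw [him]; linarith) }
  obtain ⟨c, hc⟩ := ModularForm.eq_const_of_weight_zero f
  exact ⟨c, fun z hz => congrFun hc ⟨z, hz⟩⟩

end Conway

namespace Conway
open Complex Filter Topology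

noncomputable def qq (z : ℂ) : ℂ := Complex.exp (2 * Real.pi * Complex.I * z)

noncomputable def P (x : ℂ) : ℂ := ∏' n : ℕ, (1 - x ^ (n + 1))

lemma eta_eq (z : ℂ) : _root_.eta z = ModularForm.eta z := by
  rw [_root_.eta, ModularForm.eta]
  congr 1
  · rw [Function.Periodic.qParam]; congr 1; push_cast; ring
  · congr 1; ext n; rw [ModularForm.eta_q_eq_cexp]

noncomputable def D (z : ℂ) : ℂ := _root_.eta z ^ 24

noncomputable def k (z : ℂ) : ℂ := D (2 * z) / D z

lemma norm_qq (z : ℂ) : ‖qq z‖ = Real.exp (-2 * Real.pi * z.im) := by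
  simp [qq, Complex.norm_exp]

lemma norm_qq_lt {z : ℂ} (hz : 0 < z.im) : ‖qq z‖ < 1 := by
  rw [norm_qq, Real.exp_lt_one_iff]
  have := Real.pi_pos
  nlinarith [mul_pos this hz]

lemma qq_ne (z : ℂ) : qq z ≠ 0 := Complex.exp_ne_zero _

lemma D_eq (z : ℂ) : D z = qq z * P (qq z) ^ 24 := by
  rw [D, _root_.eta, mul_pow, ← Complex.exp_nat_mul, qq, P]
  congr 2
  · push_cast; ring
  · congr 1; ext n; rw [← Complex.exp_nat_mul]; congr 2; push_cast; ring

lemma D_ne {z : ℂ} (hz : 0 < z.im) : D z ≠ 0 := by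
  rw [D, eta_eq]; exact pow_ne_zero _ (ModularForm.eta_ne_zero hz)

lemma D_diffAt {z : ℂ} (hz : 0 < z.im) : DifferentiableAt ℂ D z := by
  have : D = fun z => ModularForm.eta z ^ 24 := by ext z; rw [D, eta_eq]
  rw [this]
  exact (ModularForm.differentiableAt_eta_of_mem_upperHalfPlaneSet hz).pow 24

open UpperHalfPlane ModularForm MatrixGroups in
lemma D_mob (g : Mat) (hg : g.det = 1) {z : ℂ} (hz : 0 < z.im) :
    D (mob g z) = ((g 1 0 : ℂ) * z + (g 1 1 : ℂ)) ^ 12 * D z := by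
  obtain ⟨γ, rfl⟩ : ∃ γ : SL(2, ℤ), γ.1 = g := ⟨⟨g, hg⟩, rfl⟩
  have h := SlashInvariantForm.slash_action_generators_SL2Z
    discriminant_S_invariant discriminant_T_invariant γ
  have h2 := congrFun h ⟨z, hz⟩
  rw [SL_slash_apply] at h2
  simp only [ModularForm.discriminant, sl_smul, UpperHalfPlane.denom] at h2
  have h3 : ModularForm.eta (mob γ.1 z) ^ 24 * ((γ.1 1 0 : ℂ) * z + (γ.1 1 1 : ℂ)) ^ (-12 : ℤ)
    = ModularForm.eta z ^ 24 := by simpa using h2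
  rw [← eta_eq, ← eta_eq] at h3
  have hn := mob_denom_ne γ.1 (by rw [hg]; norm_num) hz
  rw [D, D, ← h3, zpow_neg]
  have : ((γ.1 1 0 : ℂ) * z + (γ.1 1 1 : ℂ)) ^ (12 : ℤ) = ((γ.1 1 0 : ℂ) * z + (γ.1 1 1 : ℂ)) ^ 12 := by
    exact_mod_cast rfl
  rw [this]
  field_simp

lemma im_two_mul (z : ℂ) : (2 * z).im = 2 * z.im := by simp

lemma k_ne {z : ℂ} (hz : 0 < z.im) : k z ≠ 0 :=
  div_ne_zero (D_ne (by rw [im_two_mul]; linarith)) (D_ne hz)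

lemma k_diffAt {z : ℂ} (hz : 0 < z.im) : DifferentiableAt ℂ k z := by
  have h2 : 0 < (2 * z).im := by rw [im_two_mul]; linarith
  have : DifferentiableAt ℂ (fun z => D (2 * z)) z :=
    DifferentiableAt.comp (g := D) (f := fun z => 2 * z) z (D_diffAt h2) (by fun_prop)
  exact this.div (D_diffAt hz) (D_ne hz)

lemma k_inv (g : Mat) (hg : IsG0 g) {z : ℂ} (hz : 0 < z.im) : k (mob g z) = k z := by
  obtain ⟨c, hc⟩ := hg.ev
  have hd := hg.det
  rw [Matrix.det_fin_two] at hd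
  let g' : Mat := !![g 0 0, 2 * g 0 1; c, g 1 1]
  have hg' : g'.det = 1 := by simp [g', Matrix.det_fin_two]; rw [hc] at hd; linarith
  have h2 : 0 < (2 * z).im := by rw [im_two_mul]; linarith
  have hn := mob_denom_ne g (by rw [hg.det]; norm_num) hz
  have e : 2 * mob g z = mob g' (2 * z) := by
    simp only [mob, g']
    simp
    rw [hc]; push_cast
    rw [← mul_div_assoc]; congr 1 <;> ring
  rw [k, e, D_mob g' hg' h2, D_mob g hg.det hz]
  have e2 : ((g' 1 0 : ℂ) * (2 * z) + (g' 1 1 : ℂ)) = ((g 1 0 : ℂ) * z + (g 1 1 : ℂ)) := by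
    simp [g', hc]; ring
  rw [e2, mul_div_mul_left _ _ (pow_ne_zero _ hn), k]

lemma D_S {z : ℂ} (hz : 0 < z.im) : D (-1 / z) = z ^ 12 * D z := by
  have := D_mob !![0, -1; 1, 0] (by simp [Matrix.det_fin_two]) hz
  simpa [mob] using this

lemma k_W {z : ℂ} (hz : 0 < z.im) : k (-1 / (2 * z)) = 1 / (4096 * k z) := by
  have h2 : 0 < (2 * z).im := by rw [im_two_mul]; linarith
  have hz0 : z ≠ 0 := by rintro rfl; simp at hz
  have e : 2 * (-1 / (2 * z)) = -1 / z := by field_simp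
  rw [k, e, D_S hz, D_S h2, k]
  have := D_ne hz
  have := D_ne h2
  field_simp
  norm_num

lemma qq_two (z : ℂ) : qq (2 * z) = qq z ^ 2 := by
  rw [qq, qq, ← Complex.exp_nat_mul]; congr 1; push_cast; ring

lemma mult_P {x : ℂ} (hx : ‖x‖ < 1) : Multipliable (fun n : ℕ => 1 - x ^ (n + 1)) :=
  ModularForm.multipliable_one_sub_pow hx

lemma sq_lt {x : ℂ} (hx : ‖x‖ < 1) : ‖x ^ 2‖ < 1 := by
  rw [norm_pow]; exact pow_lt_one₀ (norm_nonneg _) hx (by norm_num)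

lemma P_ne {x : ℂ} (hx : ‖x‖ < 1) : P x ≠ 0 := by
  by_cases h0 : x = 0
  · subst h0; simp [P]
  · have hz : 0 < (Function.Periodic.invQParam 1 x).im :=
      Function.Periodic.im_invQParam_pos_of_norm_lt_one one_pos hx h0
    have h1 := D_ne hz
    rw [D_eq] at h1
    have : qq (Function.Periodic.invQParam 1 x) = x := by
      have := Function.Periodic.qParam_right_inv (h := 1) one_ne_zero h0
      rw [Function.Periodic.qParam] at this
      simpa [qq] using this
    rw [this] at h1
    intro h; simp [h] at h1

lemma k_eq {z : ℂ} (hz : 0 < z.im) : k z = qq z * (P (qq z ^ 2) / P (qq z)) ^ 24 := by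
  rw [k, D_eq, D_eq, qq_two, div_pow]
  have := qq_ne z
  have := P_ne (norm_qq_lt hz)
  field_simp

lemma summ_pow {x : ℂ} (hx : ‖x‖ < 1) : Summable (fun n : ℕ => ‖x ^ (n + 1)‖) := by
  simp only [norm_pow]
  simp only [pow_succ]
  exact (summable_geometric_of_lt_one (norm_nonneg _) hx).mul_right _

lemma mult_M {x : ℂ} (hx : ‖x‖ < 1) : Multipliable (fun n : ℕ => 1 + x ^ (n + 1)) :=
  multipliable_one_add_of_summable (summ_pow hx)

lemma P_sq {x : ℂ} (hx : ‖x‖ < 1) : P (x ^ 2) = P x * ∏' n : ℕ, (1 + x ^ (n + 1)) := by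
  rw [P, P, ← (mult_P hx).tprod_mul (mult_M hx)]
  congr 1; ext n; ring

noncomputable def Po (x : ℂ) : ℂ := ∏' n : ℕ, (1 - x ^ (2 * n + 1))

lemma mult_Po {x : ℂ} (hx : ‖x‖ < 1) : Multipliable (fun n : ℕ => 1 - x ^ (2 * n + 1)) := by
  simp only [sub_eq_add_neg]
  apply multipliable_one_add_of_summable
  simp only [norm_neg]
  exact (summ_pow hx).comp_injective (i := fun n : ℕ => 2 * n) (fun a b h => by simpa using h)

lemma P_split {x : ℂ} (hx : ‖x‖ < 1) : P x = Po x * P (x ^ 2) := by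
  rw [P, ← tprod_even_mul_odd (f := fun n : ℕ => 1 - x ^ (n + 1))]
  · rw [Po, P]; congr 2; ext n; ring
  · exact mult_Po hx
  · convert mult_P (sq_lt hx) using 2 with n; ring

lemma P_three {x : ℂ} (hx : ‖x‖ < 1) : P x * P (-x) * P (x ^ 4) = P (x ^ 2) ^ 3 := by
  have hx' : ‖-x‖ < 1 := by simpa using hx
  have h1 := P_split hx
  have h2 := P_split hx'
  have h3 := P_split (sq_lt hx)
  have h4 : Po x * Po (-x) = Po (x ^ 2) := by
    rw [Po, Po, Po, ← (mult_Po hx).tprod_mul (mult_Po hx')]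
    congr 1; ext n
    rw [Odd.neg_pow ⟨n, rfl⟩]; ring
  rw [neg_sq] at h2
  have e : (x ^ 2) ^ 2 = x ^ 4 := by ring
  rw [e] at h3
  calc P x * P (-x) * P (x ^ 4) = (Po x * Po (-x)) * P (x ^ 4) * P (x ^ 2) ^ 2 := by
        rw [h1, h2]; ring
    _ = P (x ^ 2) ^ 3 := by rw [h4, ← h3]; ring

lemma D_three {z : ℂ} (hz : 0 < z.im) : D (z / 2) * D ((z + 1) / 2) * D (2 * z) = - D z ^ 3 := by
  have hx : ‖qq (z / 2)‖ < 1 := norm_qq_lt (by simpa using hz)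
  have e1 : qq ((z + 1) / 2) = - qq (z / 2) := by
    rw [qq, qq, show 2 * Real.pi * I * ((z + 1) / 2) = 2 * Real.pi * I * (z / 2) + Real.pi * I by ring,
      Complex.exp_add, Complex.exp_pi_mul_I]; ring
  have e2 : qq z = qq (z / 2) ^ 2 := by rw [← qq_two]; congr 1; ring
  have h := P_three hx
  rw [D_eq, D_eq, D_eq, D_eq, qq_two, e1, e2]
  have e3 : (qq (z / 2) ^ 2) ^ 2 = qq (z / 2) ^ 4 := by ring
  rw [e3]
  calc _ = - qq (z / 2) ^ 6 * (P (qq (z / 2)) * P (-qq (z / 2)) * P (qq (z / 2) ^ 4)) ^ 24 := by ring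
    _ = _ := by rw [h]; ring

end Conway

namespace Conway
open Complex Filter Topology

lemma tprod_bound {f : ℕ → ℂ} (hf : Summable fun n => ‖f n‖) :
    ‖∏' n, (1 + f n) - 1‖ ≤ Real.exp (∑' n, ‖f n‖) - 1 := by
  have h := (multipliable_one_add_of_summable hf).hasProd
  have h2 : Tendsto (fun s : Finset ℕ => ‖∏ i ∈ s, (1 + f i) - 1‖) atTop
      (𝓝 ‖∏' n, (1 + f n) - 1‖) := (Tendsto.sub_const h 1).norm
  refine le_of_tendsto h2 (Eventually.of_forall fun s => ?_)
  refine (s.norm_prod_one_add_sub_one_le f).trans ?_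
  gcongr
  exact hf.sum_le_tsum s (fun _ _ => norm_nonneg _)

noncomputable def M (x : ℂ) : ℂ := ∏' n : ℕ, (1 + x ^ (n + 1))

lemma k_eqM {z : ℂ} (hz : 0 < z.im) : k z = qq z * M (qq z) ^ 24 := by
  rw [k_eq hz, P_sq (norm_qq_lt hz), mul_div_cancel_left₀ _ (P_ne (norm_qq_lt hz)), M]

lemma M_bound {x : ℂ} (hx : ‖x‖ < 1) : ‖M x‖ ≤ Real.exp (1 / (1 - ‖x‖)) := by
  have h := tprod_bound (summ_pow hx)
  have e : ∑' n : ℕ, ‖x ^ (n + 1)‖ ≤ 1 / (1 - ‖x‖) := by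
    rw [one_div, ← tsum_geometric_of_lt_one (norm_nonneg _) hx]
    refine Summable.tsum_le_tsum (fun n => ?_) (summ_pow hx)
      (summable_geometric_of_lt_one (norm_nonneg _) hx)
    rw [norm_pow]
    exact pow_le_pow_of_le_one (norm_nonneg _) hx.le (by omega)
  have h1 : ‖M x‖ ≤ ‖M x - 1‖ + 1 := by
    have := norm_add_le (M x - 1) 1
    simpa using this
  have := Real.exp_le_exp.mpr e
  rw [M] at *
  linarith

lemma k_bound {z : ℂ} (hz : 0 < z.im) : ‖k z‖ ≤ Real.exp (24 / (1 - ‖qq z‖)) := by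
  rw [k_eqM hz, norm_mul, norm_pow]
  have h := M_bound (norm_qq_lt hz)
  have h1 := norm_qq_lt hz
  calc ‖qq z‖ * ‖M (qq z)‖ ^ 24 ≤ 1 * Real.exp (1 / (1 - ‖qq z‖)) ^ 24 := by gcongr
    _ = Real.exp (24 / (1 - ‖qq z‖)) := by
      rw [one_mul, ← Real.exp_nat_mul]; congr 1; push_cast; ring

noncomputable def R (x : ℂ) : ℂ := ∏' n : ℕ, (1 + x ^ (n + 2))

lemma summ_R {x : ℂ} (hx : ‖x‖ < 1) : Summable (fun n : ℕ => ‖x ^ (n + 2)‖) :=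
  (summ_pow hx).comp_injective (i := fun n : ℕ => n + 1) (fun a b h => by simpa using h)

lemma M_R {x : ℂ} (hx : ‖x‖ < 1) : M x = (1 + x) * R x := by
  have h := tprod_eq_zero_mul' (f := fun n : ℕ => 1 + x ^ (n + 1))
    (multipliable_one_add_of_summable (f := fun n : ℕ => x ^ (n + 2)) (summ_R hx))
  rw [M, h]
  simp [R]

lemma R_zero : R 0 = 1 := by simp [R]

lemma R_bound {x : ℂ} (hx : ‖x‖ ≤ 1 / 2) : ‖R x - 1‖ ≤ 4 * ‖x‖ ^ 2 := by
  have hx1 : ‖x‖ < 1 := by linarith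
  have h := tprod_bound (summ_R hx1)
  have e : ∑' n : ℕ, ‖x ^ (n + 2)‖ ≤ 2 * ‖x‖ ^ 2 := by
    simp only [norm_pow]
    simp only [pow_add]
    rw [tsum_mul_right, tsum_geometric_of_lt_one (norm_nonneg _) hx1]
    gcongr
    rw [inv_le_comm₀ (by linarith) (by norm_num)]; linarith
  have h2 : Real.exp (2 * ‖x‖ ^ 2) - 1 ≤ 2 * (2 * ‖x‖ ^ 2) := by
    have h3 : |2 * ‖x‖ ^ 2| ≤ 1 := by
      rw [abs_of_nonneg (by positivity)]
      nlinarith [norm_nonneg x]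
    have := Real.abs_exp_sub_one_le h3
    rw [abs_of_nonneg (a := 2 * ‖x‖ ^ 2) (by positivity)] at this
    exact (le_abs_self _).trans this
  have := Real.exp_le_exp.mpr e
  rw [R]
  linarith

lemma R_deriv : HasDerivAt R 0 0 := by
  rw [hasDerivAt_iff_isLittleO]
  simp only [sub_zero, smul_zero, R_zero]
  have h1 : (fun x => R x - 1) =O[𝓝 0] fun x : ℂ => x ^ 2 := by
    refine Asymptotics.IsBigO.of_bound 4 ?_
    filter_upwards [Metric.closedBall_mem_nhds (0 : ℂ) (by norm_num : (0:ℝ) < 1 / 2)] with x hx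
    rw [norm_pow]
    exact R_bound (by simpa using hx)
  exact h1.trans_isLittleO (Asymptotics.isLittleO_pow_id (by norm_num))

lemma M_deriv : HasDerivAt M 1 0 := by
  have h : HasDerivAt (fun x : ℂ => (1 + x) * R x) (1 * R 0 + (1 + 0) * 0) 0 :=
    ((hasDerivAt_id (0 : ℂ)).const_add 1).mul R_deriv
  rw [R_zero] at h
  refine (h.congr_deriv (by ring)).congr_of_eventuallyEq ?_
  filter_upwards [Metric.ball_mem_nhds (0 : ℂ) one_pos] with x hx
  exact M_R (by simpa using hx)

lemma M_zero : M 0 = 1 := by simp [M]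

def Iinf : Filter ℂ := comap Complex.im atTop

lemma qq_tendsto : Tendsto qq Iinf (𝓝[≠] 0) := by
  rw [tendsto_nhdsWithin_iff]
  refine ⟨?_, Eventually.of_forall fun z => qq_ne z⟩
  rw [tendsto_zero_iff_norm_tendsto_zero]
  simp only [norm_qq]
  refine Real.tendsto_exp_atBot.comp ?_
  have : Tendsto (fun y : ℝ => -2 * Real.pi * y) atTop atBot :=
    tendsto_id.const_mul_atTop_of_neg (by have := Real.pi_pos; linarith)
  exact this.comp tendsto_comap

lemma ev_im (Y : ℝ) : ∀ᶠ z in Iinf, Y < z.im := tendsto_comap.eventually (eventually_gt_atTop Y)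

lemma Iinf_ev {p : ℂ → Prop} (h : ∀ᶠ z in Iinf, p z) : ∃ Y : ℝ, 0 < Y ∧ ∀ z : ℂ, Y < z.im → p z := by
  rw [Iinf, eventually_comap] at h
  obtain ⟨Y, hY⟩ := eventually_atTop.mp h
  exact ⟨max Y 1, by positivity, fun z hz => hY z.im ((le_max_left _ _).trans hz.le) z rfl⟩

instance : Iinf.NeBot := by
  refine ⟨fun h => ?_⟩
  obtain ⟨Y, -, hY⟩ := Iinf_ev (p := fun _ => False) (by rw [h]; exact Filter.eventually_bot)
  exact hY (((Y + 1 : ℝ) : ℂ) * I) (by simp)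

lemma k_tend_one : Tendsto (fun z => k z / qq z) Iinf (𝓝 1) := by
  have h : Tendsto (fun x => M x ^ 24) (𝓝[≠] 0) (𝓝 1) := by
    have : Tendsto (fun x => M x ^ 24) (𝓝 0) (𝓝 (M 0 ^ 24)) := M_deriv.continuousAt.tendsto.pow 24
    simp only [M_zero, one_pow] at this
    exact this.mono_left nhdsWithin_le_nhds
  refine (h.comp qq_tendsto).congr' ?_
  filter_upwards [ev_im 0] with z hz
  rw [k_eqM hz, mul_div_cancel_left₀ _ (qq_ne z)]; rfl

lemma h_tend : Tendsto (fun z => 1 / k z - 1 / qq z) Iinf (𝓝 (-24)) := by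
  have hd : HasDerivAt (fun x => (M x ^ 24)⁻¹) (-24) 0 := by
    have := (M_deriv.pow 24).inv (by simp [M_zero])
    refine this.congr_deriv (by simp [M_zero])
  have := (hasDerivAt_iff_tendsto_slope.mp hd).comp qq_tendsto
  refine this.congr' ?_
  filter_upwards [ev_im 0] with z hz
  rw [Function.comp, slope_def_field, M_zero, k_eqM hz, one_div, one_div, mul_inv]
  have := qq_ne z
  field_simp
  simp

lemma tend_bdd {f : ℂ → ℂ} {c : ℂ} (h : Tendsto f Iinf (𝓝 c)) :
    ∃ Y : ℝ, 0 < Y ∧ ∀ z : ℂ, Y < z.im → ‖f z‖ ≤ ‖c‖ + 1 := by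
  have := h.norm.eventually_le_const (lt_add_one ‖c‖)
  exact Iinf_ev this

lemma k_tend_zero : Tendsto k Iinf (𝓝 0) := by
  have := k_tend_one.mul (qq_tendsto.mono_right nhdsWithin_le_nhds)
  simp only [one_mul] at this
  refine this.congr fun z => ?_
  rw [div_mul_cancel₀ _ (qq_ne z)]

end Conway

namespace Conway
open Complex Filter Topology

def Rel (M N : Mat) : Prop := ∃ g : Mat, IsG0 g ∧ N = g * M

lemma IsG0.mul {g h : Mat} (hg : IsG0 g) (hh : IsG0 h) : IsG0 (g * h) := by
  refine ⟨by rw [Matrix.det_mul, hg.det, hh.det, one_mul], ?_⟩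
  rw [Matrix.mul_apply, Fin.sum_univ_two]
  exact (hg.ev.mul_right _).add (hh.ev.mul_left _)

lemma IsG0.adj {g : Mat} (hg : IsG0 g) : IsG0 g.adjugate := by
  refine ⟨by rw [Matrix.det_adjugate, hg.det]; simp, ?_⟩
  rw [Matrix.adjugate_fin_two]
  simpa using hg.ev

lemma IsG0.adj_mul {g : Mat} (hg : IsG0 g) : g.adjugate * g = 1 := by
  rw [Matrix.adjugate_mul, hg.det, one_smul]

lemma IsG0.mul_adj {g : Mat} (hg : IsG0 g) : g * g.adjugate = 1 := by
  rw [Matrix.mul_adjugate, hg.det, one_smul]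

lemma Rel.symm {M N : Mat} (h : Rel M N) : Rel N M := by
  obtain ⟨g, hg, rfl⟩ := h
  exact ⟨g.adjugate, hg.adj, by rw [← mul_assoc, hg.adj_mul, one_mul]⟩

lemma Rel.trans {M N K : Mat} (h : Rel M N) (h' : Rel N K) : Rel M K := by
  obtain ⟨g, hg, rfl⟩ := h
  obtain ⟨g', hg', rfl⟩ := h'
  exact ⟨g' * g, hg'.mul hg, by rw [mul_assoc]⟩

lemma Rel.mul_right {M N : Mat} (h : Rel M N) (g : Mat) : Rel (M * g) (N * g) := by
  obtain ⟨g', hg', rfl⟩ := h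
  exact ⟨g', hg', by rw [mul_assoc]⟩

lemma sum_rel {ι κ : Type*} (s : Finset ι) (t : Finset κ) (f : ι → Mat) (g : κ → Mat) (φ : Mat → ℂ)
    (hφ : ∀ i ∈ s, ∀ j ∈ t, Rel (f i) (g j) → φ (f i) = φ (g j))
    (h1 : ∀ i ∈ s, ∃ j ∈ t, Rel (f i) (g j)) (h2 : ∀ j ∈ t, ∃ i ∈ s, Rel (f i) (g j))
    (i1 : ∀ i ∈ s, ∀ i' ∈ s, Rel (f i) (f i') → i = i')
    (i2 : ∀ j ∈ t, ∀ j' ∈ t, Rel (g j) (g j') → j = j') :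
    ∑ i ∈ s, φ (f i) = ∑ j ∈ t, φ (g j) := by
  choose e he her using h1
  refine Finset.sum_bij e he ?_ ?_ ?_
  · intro i hi i' hi' h
    have h' := (her i' hi').symm
    rw [← h] at h'
    exact i1 i hi i' hi' ((her i hi).trans h')
  · intro j hj
    obtain ⟨i, hi, hr⟩ := h2 j hj
    exact ⟨i, hi, i2 _ (he i hi) _ hj ((her i hi).symm.trans hr)⟩
  · intro i hi
    exact hφ i hi _ (he i hi) (her i hi)

def hs (m : ℕ) : Finset (Σ _ : ℕ, ℕ) :=
  (m.divisors.filter Odd).sigma fun a => Finset.range (m / a)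

def rep (m : ℕ) (i : Σ _ : ℕ, ℕ) : Mat := !![(i.1 : ℤ), (i.2 : ℤ); 0, ((m / i.1 : ℕ) : ℤ)]

lemma mem_hs {m : ℕ} {i : Σ _ : ℕ, ℕ} :
    i ∈ hs m ↔ (i.1 ∣ m ∧ m ≠ 0) ∧ Odd i.1 ∧ i.2 < m / i.1 := by
  simp [hs, and_assoc]

lemma hs_mul {m : ℕ} {i : Σ _ : ℕ, ℕ} (h : i ∈ hs m) : (i.1 : ℤ) * ((m / i.1 : ℕ) : ℤ) = m := by
  rw [mem_hs] at h
  exact_mod_cast Nat.mul_div_cancel' h.1.1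

lemma rep_det {m : ℕ} {i : Σ _ : ℕ, ℕ} (h : i ∈ hs m) : (rep m i).det = m := by
  rw [rep, Matrix.det_fin_two_of, hs_mul h]; simp

structure IsS (m : ℕ) (M : Mat) : Prop where
  det : M.det = m
  ev : Even (M 1 0)
  od : Odd (M 0 0)

lemma rep_S {m : ℕ} {i : Σ _ : ℕ, ℕ} (h : i ∈ hs m) : IsS m (rep m i) :=
  ⟨rep_det h, by simp [rep], by
    rw [mem_hs] at h
    simpa [rep] using h.2.1⟩

lemma IsG0.odd {g : Mat} (hg : IsG0 g) : Odd (g 0 0) := by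
  have h := hg.det
  rw [Matrix.det_fin_two] at h
  have h3 : Even (g 0 1 * g 1 0) := hg.ev.mul_left _
  have h2 : Odd (g 0 0 * g 1 1) := by
    rw [show g 0 0 * g 1 1 = 1 + g 0 1 * g 1 0 by linarith]
    exact odd_one.add_even h3
  exact (Int.odd_mul.mp h2).1

lemma IsS.mul {m : ℕ} {M g : Mat} (hM : IsS m M) (hg : IsG0 g) : IsS m (M * g) := by
  refine ⟨by rw [Matrix.det_mul, hg.det, mul_one, hM.det], ?_, ?_⟩
  · rw [Matrix.mul_apply, Fin.sum_univ_two]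
    exact (hM.ev.mul_right _).add (hg.ev.mul_left _)
  · rw [Matrix.mul_apply, Fin.sum_univ_two]
    exact (hM.od.mul hg.odd).add_even (hg.ev.mul_left _)

lemma reduce {m : ℕ} (hm : 0 < m) {M : Mat} (hM : IsS m M) : ∃ i ∈ hs m, Rel M (rep m i) := by
  obtain ⟨hd, ⟨c2, hc2⟩, ho⟩ := hM
  rw [Matrix.det_fin_two] at hd
  set a := M 0 0 with ha
  set b := M 0 1 with hb
  set c := M 1 0 with hc
  set d := M 1 1 with hdd
  have ha0 : a ≠ 0 := by rintro h; rw [h] at ho; simp at ho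
  have hgpos : 0 < Int.gcd a c := Int.gcd_pos_of_ne_zero_left _ ha0
  set n := Int.gcd a c with hn
  obtain ⟨a', ha'⟩ : (n : ℤ) ∣ a := Int.gcd_dvd_left ..
  obtain ⟨c', hc'⟩ : (n : ℤ) ∣ c := Int.gcd_dvd_right ..
  have hnodd : Odd (n : ℤ) := by
    rw [ha'] at ho; exact (Int.odd_mul.mp ho).1
  have hc'ev : Even c' := by
    have : Even ((n : ℤ) * c') := by rw [← hc']; exact ⟨c2, hc2⟩
    rcases Int.even_mul.mp this with h | h
    · exact absurd h (Int.not_even_iff_odd.mpr hnodd)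
    · exact h
  have hbez : (n : ℤ) = a * Int.gcdA a c + c * Int.gcdB a c := Int.gcd_eq_gcd_ab a c
  set x := Int.gcdA a c
  set y := Int.gcdB a c
  have hn0 : (n : ℤ) ≠ 0 := by exact_mod_cast hgpos.ne'
  have hxy : a' * x + c' * y = 1 := by
    apply mul_left_cancel₀ hn0
    have e : (n : ℤ) * (a' * x + c' * y) = (n * a') * x + (n * c') * y := by ring
    rw [e, ← ha', ← hc', mul_one, ← hbez]
  set Dd := a' * d - c' * b with hDd
  have hnD : (n : ℤ) * Dd = m := by
    have e : (n : ℤ) * Dd = (n * a') * d - (n * c') * b := by rw [hDd]; ring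
    rw [e, ← ha', ← hc', ← hd]; ring
  have hDpos : 0 < Dd := by
    have : (0 : ℤ) < n * Dd := by rw [hnD]; exact_mod_cast hm
    exact pos_of_mul_pos_right this (by positivity)
  obtain ⟨D', hD'⟩ := Int.eq_ofNat_of_zero_le hDpos.le
  have hmn : n * D' = m := by rw [hD'] at hnD; exact_mod_cast hnD
  have hdiv : m / n = D' := by rw [← hmn]; exact Nat.mul_div_cancel_left _ hgpos
  set b0 := x * b + y * d with hb0
  obtain ⟨b1, hb1⟩ := Int.eq_ofNat_of_zero_le (Int.emod_nonneg b0 hDpos.ne')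
  have hb1lt : b0 % Dd < Dd := Int.emod_lt_of_pos _ hDpos
  set t := b0 / Dd with ht
  have hdm : b0 % Dd = b0 - Dd * t := by rw [Int.emod_def]
  refine ⟨⟨n, b1⟩, ?_, ?_⟩
  · rw [mem_hs]
    refine ⟨⟨⟨D', hmn.symm⟩, hm.ne'⟩, by exact_mod_cast hnodd, ?_⟩
    simp only
    rw [hdiv]
    rw [hb1, hD'] at hb1lt
    exact_mod_cast hb1lt
  · refine ⟨!![x + t * c', y - t * a'; -c', a'], ⟨?_, ?_⟩, ?_⟩
    · rw [Matrix.det_fin_two_of]; linear_combination hxy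
    · simpa using hc'ev
    · ext i j
      fin_cases i <;> fin_cases j <;>
        simp [rep, Matrix.mul_apply, Fin.sum_univ_two, ← ha, ← hb, ← hc, ← hdd]
      · linear_combination hbez - t * c' * ha' + t * a' * hc'
      · linear_combination -hb1 + hdm
      · linear_combination c' * ha' - a' * hc'
      · have h0 : ((m / n : ℕ) : ℤ) = D' := by rw [hdiv]
        push_cast at h0
        linear_combination h0 - hD'

lemma aux_unit {x v : ℤ} {a a' : ℕ} (ha : 0 < a') (h : (a' : ℤ) = x * a) (h1 : x * v = 1) :
    x = 1 ∧ v = 1 := by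
  have hx : 0 < x := by
    have : (0:ℤ) < x * a := by rw [← h]; exact_mod_cast ha
    exact pos_of_mul_pos_left this (by positivity)
  have := Int.eq_one_or_neg_one_of_mul_eq_one h1
  rcases this with rfl | rfl
  · exact ⟨rfl, by linarith⟩
  · omega

lemma aux_mod {b b' d : ℕ} {y : ℤ} (h : b < d) (h' : b' < d) (e : (b' : ℤ) = b + y * d) : b = b' := by
  have h1 : (b' : ℤ) % d = b' := Int.emod_eq_of_lt (by positivity) (by exact_mod_cast h')
  have h2 : (b : ℤ) % d = b := Int.emod_eq_of_lt (by positivity) (by exact_mod_cast h)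
  have : (b' : ℤ) % d = b % d := by rw [e]; simp
  rw [h1, h2] at this
  exact_mod_cast this.symm

lemma rep_inj {m : ℕ} {i j : Σ _ : ℕ, ℕ} (hi : i ∈ hs m) (hj : j ∈ hs m)
    (h : Rel (rep m i) (rep m j)) : i = j := by
  obtain ⟨g, hg, he⟩ := h
  have hdet := hg.det
  rw [Matrix.det_fin_two] at hdet
  obtain ⟨a, b⟩ := i
  obtain ⟨a', b'⟩ := j
  rw [mem_hs] at hi hj
  obtain ⟨⟨hi1, hm⟩, hi2, hi3⟩ := hi
  obtain ⟨⟨hj1, -⟩, hj2, hj3⟩ := hj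
  simp only at *
  have e00 := congrFun (congrFun he 0) 0
  have e01 := congrFun (congrFun he 0) 1
  have e10 := congrFun (congrFun he 1) 0
  simp only [rep, Matrix.mul_apply, Fin.sum_univ_two, Matrix.of_apply, Matrix.cons_val', Matrix.cons_val_zero,
    Matrix.cons_val_one, Matrix.cons_val_fin_one, mul_zero, add_zero] at e00 e01 e10
  have hapos : 0 < a := hi2.pos
  have hw : g 1 0 = 0 := by
    rcases mul_eq_zero.mp e10.symm with h | h
    · exact h
    · exact absurd h (by exact_mod_cast hapos.ne')
  obtain ⟨hx, hv⟩ := aux_unit hj2.pos e00 (v := g 1 1) (by rw [hw] at hdet; linarith)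
  rw [hx, one_mul] at e00
  have e00' : a' = a := by exact_mod_cast e00
  subst e00'
  rw [hx, one_mul] at e01
  rw [aux_mod hi3 hj3 e01]

noncomputable def T (m : ℕ) (f : ℂ → ℂ) (z : ℂ) : ℂ := ∑ i ∈ hs m, f (mob (rep m i) z)

lemma phi_inv {f : ℂ → ℂ} (hf : ∀ g : Mat, IsG0 g → ∀ z : ℂ, 0 < z.im → f (mob g z) = f z)
    {M N : Mat} (hM : 0 < M.det) (h : Rel M N) {z : ℂ} (hz : 0 < z.im) :
    f (mob M z) = f (mob N z) := by
  obtain ⟨g, hg, rfl⟩ := h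
  rw [mob_mul g M (by rw [hg.det]; norm_num) hM hz, hf g hg _ (mob_im_pos M hM hz)]

lemma T_inv {f : ℂ → ℂ} (hf : ∀ g : Mat, IsG0 g → ∀ z : ℂ, 0 < z.im → f (mob g z) = f z)
    {m : ℕ} (hm : 0 < m) (g : Mat) (hg : IsG0 g) {z : ℂ} (hz : 0 < z.im) :
    T m f (mob g z) = T m f z := by
  have hm' : (0 : ℤ) < m := by exact_mod_cast hm
  have h1 : T m f (mob g z) = ∑ i ∈ hs m, f (mob (rep m i * g) z) := by
    refine Finset.sum_congr rfl fun i hi => ?_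
    rw [mob_mul _ _ (by rw [rep_det hi]; exact hm') (by rw [hg.det]; norm_num) hz]
  rw [h1, T]
  symm
  refine sum_rel (hs m) (hs m) (rep m) (fun i => rep m i * g) (fun M => f (mob M z)) ?_ ?_ ?_ ?_ ?_
  · intro i hi j hj h
    exact phi_inv hf (by rw [rep_det hi]; exact hm') h hz
  · intro i hi
    obtain ⟨j, hj, hr⟩ := reduce hm ((rep_S hi).mul hg.adj)
    refine ⟨j, hj, ?_⟩
    have := hr.mul_right g
    rwa [mul_assoc, hg.adj_mul, mul_one] at this
  · intro j hj
    obtain ⟨i, hi, hr⟩ := reduce hm ((rep_S hj).mul hg)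
    exact ⟨i, hi, hr.symm⟩
  · intro i hi j hj h
    exact rep_inj hi hj h
  · intro i hi j hj h
    have := h.mul_right g.adjugate
    simp only [mul_assoc, hg.mul_adj, mul_one] at this
    exact rep_inj hi hj this

def hl (m : ℕ) : Finset (Σ _ : ℕ, ℕ) :=
  (m.divisors.filter Odd).sigma fun a => Finset.range a

def low (m : ℕ) (i : Σ _ : ℕ, ℕ) : Mat := !![(i.1 : ℤ), 0; -(2 * (i.2 : ℤ)), ((m / i.1 : ℕ) : ℤ)]

lemma mem_hl {m : ℕ} {i : Σ _ : ℕ, ℕ} :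
    i ∈ hl m ↔ (i.1 ∣ m ∧ m ≠ 0) ∧ Odd i.1 ∧ i.2 < i.1 := by
  simp [hl, and_assoc]

lemma low_S {m : ℕ} {i : Σ _ : ℕ, ℕ} (h : i ∈ hl m) : IsS m (low m i) := by
  rw [mem_hl] at h
  refine ⟨?_, by simp [low], by simpa [low] using h.2.1⟩
  have := Nat.mul_div_cancel' h.1.1
  rw [low, Matrix.det_fin_two_of, zero_mul, sub_zero]
  exact_mod_cast this

lemma low_inj {m : ℕ} {i j : Σ _ : ℕ, ℕ} (hi : i ∈ hl m) (hj : j ∈ hl m)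
    (h : Rel (low m i) (low m j)) : i = j := by
  obtain ⟨g, hg, he⟩ := h
  have hdet := hg.det
  rw [Matrix.det_fin_two] at hdet
  obtain ⟨a, b⟩ := i
  obtain ⟨a', b'⟩ := j
  rw [mem_hl] at hi hj
  obtain ⟨⟨hi1, hm⟩, hi2, hi3⟩ := hi
  obtain ⟨⟨hj1, -⟩, hj2, hj3⟩ := hj
  simp only at *
  have hmp : 0 < m := Nat.pos_of_ne_zero hm
  have e00 := congrFun (congrFun he 0) 0
  have e01 := congrFun (congrFun he 0) 1
  have e10 := congrFun (congrFun he 1) 0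
  have e11 := congrFun (congrFun he 1) 1
  simp only [low, Matrix.mul_apply, Fin.sum_univ_two, Matrix.of_apply, Matrix.cons_val', Matrix.cons_val_zero,
    Matrix.cons_val_one, Matrix.cons_val_fin_one, mul_zero, zero_add] at e00 e01 e10 e11
  have hp : 0 < m / a := Nat.div_pos (Nat.le_of_dvd hmp hi1) hi2.pos
  have hp' : 0 < m / a' := Nat.div_pos (Nat.le_of_dvd hmp hj1) hj2.pos
  have hw : g 0 1 = 0 := by
    rcases mul_eq_zero.mp e01.symm with h | h
    · exact h
    · exact absurd h (by exact_mod_cast hp.ne')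
  obtain ⟨hv, hx⟩ := aux_unit hp' e11 (v := g 0 0) (by rw [hw] at hdet; linarith)
  rw [hx, hw, one_mul, zero_mul, add_zero] at e00
  have e00' : a' = a := by exact_mod_cast e00
  subst e00'
  obtain ⟨w, hw⟩ := hg.ev
  rw [hv, hw] at e10
  rw [aux_mod hi3 hj3 (y := -w) (by linarith)]

lemma reduce_low {m : ℕ} {i : Σ _ : ℕ, ℕ} (hi : i ∈ hs m) (b' d' : ℤ) (n : ℕ) (hn : 0 < n)
    (hb : (i.2 : ℤ) = n * b') (hd : ((m / i.1 : ℕ) : ℤ) = n * d') (hcop : IsCoprime b' d')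
    (hodd : Odd d') : ∃ j ∈ hl m, Rel (rep m i) (low m j) := by
  have hmul := hs_mul hi
  obtain ⟨a, b⟩ := i
  rw [mem_hs] at hi
  obtain ⟨⟨hi1, hm⟩, hi2, hi3⟩ := hi
  simp only at *
  have hmp : 0 < m := Nat.pos_of_ne_zero hm
  have hp : 0 < m / a := Nat.div_pos (Nat.le_of_dvd hmp hi1) hi2.pos
  have hd'pos : 0 < d' := by
    have : (0:ℤ) < n * d' := by rw [← hd]; exact_mod_cast hp
    exact pos_of_mul_pos_right this (by positivity)
  obtain ⟨dn, rfl⟩ := Int.eq_ofNat_of_zero_le hd'pos.le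
  have hcop2 : IsCoprime (2 * b') (dn : ℤ) := by
    refine IsCoprime.mul_left ?_ hcop
    obtain ⟨t, ht⟩ := hodd
    exact ⟨-t, 1, by rw [ht]; ring⟩
  obtain ⟨w, v, hwv⟩ := hcop2
  have hDpos : (0:ℤ) < ((dn * a : ℕ) : ℤ) := by
    push_cast; exact mul_pos hd'pos (by exact_mod_cast hi2.pos)
  set Dn := dn * a with hDn
  obtain ⟨B, hB⟩ := Int.eq_ofNat_of_zero_le (Int.emod_nonneg (-(w * a)) hDpos.ne')
  have hBlt : (-(w * a)) % (Dn : ℤ) < Dn := Int.emod_lt_of_pos _ hDpos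
  set t := (-(w * a)) / (Dn : ℤ) with ht
  have hdm : (-(w * a)) % (Dn : ℤ) = (-(w * a)) - Dn * t := by rw [Int.emod_def]
  have hDm : Dn * n = m := by
    have : ((Dn * n : ℕ) : ℤ) = m := by
      rw [← hmul, hd, hDn]; push_cast; ring
    exact_mod_cast this
  have hdiv : m / Dn = n := by
    rw [← hDm]; exact Nat.mul_div_cancel_left _ (by exact_mod_cast hDpos)
  refine ⟨⟨Dn, B⟩, ?_, ?_⟩
  · rw [mem_hl]
    refine ⟨⟨⟨n, hDm.symm⟩, hm⟩, ?_, ?_⟩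
    · exact Odd.mul (by exact_mod_cast hodd) hi2
    · rw [hB] at hBlt
      exact_mod_cast hBlt
  · refine ⟨!![(dn : ℤ), -b'; 2 * w + 2 * t * dn, v - 2 * t * b'], ⟨?_, ?_⟩, ?_⟩
    · rw [Matrix.det_fin_two_of]; linear_combination hwv
    · exact ⟨w + t * dn, by simp; ring⟩
    · have h0 : ((m / Dn : ℕ) : ℤ) = n := by rw [hdiv]
      have hDnc : (Dn : ℤ) = dn * a := by rw [hDn]; push_cast; ring
      ext i j
      fin_cases i <;> fin_cases j <;>
        simp only [rep, low, Matrix.mul_apply, Fin.sum_univ_two, Matrix.of_apply, Matrix.cons_val', Matrix.cons_val_zero,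
          Matrix.cons_val_one, Matrix.cons_val_fin_one, mul_zero, add_zero, Fin.zero_eta, Fin.mk_one]
      · exact hDnc
      · rw [hb, hd]; ring
      · linear_combination 2 * hB - 2 * hdm + 2 * t * hDnc
      · rw [hb, hd, h0]; linear_combination -n * hwv

end Conway

namespace Conway
open Complex Filter Topology Asymptotics

def up (a b d : ℤ) : Mat := !![a, b; 0, d]

lemma mob_up (a b d : ℤ) (z : ℂ) : mob (up a b d) z = (a * z + b) / d := by
  simp [mob, up]

lemma mob_up_im (a b d : ℤ) (z : ℂ) : (mob (up a b d) z).im = (a / d : ℝ) * z.im := by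
  rw [mob_up]
  have : ((a * z + b) / d : ℂ) = ((a / d : ℝ) : ℂ) * z + ((b / d : ℝ) : ℂ) := by
    push_cast; ring
  rw [this]
  simp

lemma mob_up_tendsto {a d : ℤ} (b : ℤ) (ha : 0 < a) (hd : 0 < d) :
    Tendsto (mob (up a b d)) Iinf Iinf := by
  rw [Iinf, tendsto_comap_iff]
  have : (Complex.im ∘ mob (up a b d)) = fun z => (a / d : ℝ) * z.im := by
    ext z; exact mob_up_im a b d z
  rw [this]
  have h : (0:ℝ) < a / d := by
    have : (0:ℝ) < a := by exact_mod_cast ha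
    have : (0:ℝ) < d := by exact_mod_cast hd
    positivity
  exact tendsto_comap.const_mul_atTop h

def Wm : Mat := !![0, -1; 2, 0]

lemma Wm_det : Wm.det = 2 := by simp [Wm, Matrix.det_fin_two]

lemma mob_Wm (z : ℂ) : mob Wm z = -1 / (2 * z) := by simp [mob, Wm]

lemma k_inv' : ∀ g : Mat, IsG0 g → ∀ z : ℂ, 0 < z.im → k (mob g z) = k z :=
  fun g hg _ hz => k_inv g hg hz

lemma k_O : k =O[Iinf] fun _ => (1 : ℝ) := k_tend_zero.isBigO_one ℝ

lemma h_O : (fun z => 1 / k z - 1 / qq z) =O[Iinf] fun _ => (1 : ℝ) := h_tend.isBigO_one ℝ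

lemma bad_bdd {m : ℕ} {i : Σ _ : ℕ, ℕ} (hi : i ∈ hs m)
    (hbad : ¬ ∃ j ∈ hl m, Rel (rep m i) (low m j)) :
    (fun z => k (mob (rep m i) (-1 / (2 * z)))) =O[Iinf] fun _ => (1 : ℝ) := by
  obtain ⟨b', d', hc, hb, hd⟩ := Nat.exists_coprime i.2 (m / i.1)
  have hdet := rep_det hi
  have hi' := hi
  rw [mem_hs] at hi'
  obtain ⟨⟨hi1, hm⟩, hi2, hi3⟩ := hi'
  have hmp : 0 < m := Nat.pos_of_ne_zero hm
  have hp : 0 < m / i.1 := Nat.div_pos (Nat.le_of_dvd hmp hi1) hi2.pos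
  set n := Nat.gcd i.2 (m / i.1) with hn
  have hnp : 0 < n := Nat.gcd_pos_of_pos_right _ hp
  have hd'p : 0 < d' := by
    rcases Nat.eq_zero_or_pos d' with h | h
    · rw [h] at hd; omega
    · exact h
  have hev : Even (d' : ℤ) := by
    by_contra hodd
    rw [Int.not_even_iff_odd] at hodd
    refine hbad (reduce_low hi b' d' n hnp ?_ ?_ (Nat.isCoprime_iff_coprime.mpr hc) hodd)
    · rw [mul_comm]; exact_mod_cast hb
    · rw [mul_comm]; exact_mod_cast hd
  obtain ⟨v, y, hvy⟩ := Nat.isCoprime_iff_coprime.mpr hc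
  set g : Mat := !![(b' : ℤ), -y; d', v] with hg
  have hg0 : IsG0 g := ⟨by rw [hg, Matrix.det_fin_two_of]; linear_combination hvy, by simpa [hg] using hev⟩
  have key : rep m i * Wm = g * up (2 * n) (-(i.1 * v)) (i.1 * d') := by
    have hbz : (i.2 : ℤ) = b' * n := by exact_mod_cast hb
    have hdz : ((m / i.1 : ℕ) : ℤ) = d' * n := by exact_mod_cast hd
    ext r c
    fin_cases r <;> fin_cases c <;>
      simp only [rep, Wm, up, hg, Matrix.mul_apply, Fin.sum_univ_two, Matrix.of_apply, Matrix.cons_val', Matrix.cons_val_zero,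
          Matrix.cons_val_one, Matrix.cons_val_fin_one, mul_zero, add_zero, Fin.zero_eta, Fin.mk_one]
    · linear_combination 2 * hbz
    · linear_combination (i.1 : ℤ) * hvy
    · linear_combination 2 * hdz
    · ring
  have hA : (0 : ℤ) < 2 * n := by positivity
  have hB : (0 : ℤ) < i.1 * d' := by
    have := hi2.pos
    positivity
  refine (k_O.comp_tendsto (mob_up_tendsto (-(i.1 * v)) hA hB)).congr' ?_ EventuallyEq.rfl
  filter_upwards [ev_im 0] with z hz
  have hmz : (0 : ℤ) < m := by exact_mod_cast hmp
  have hup : 0 < (up (2 * n) (-(i.1 * v)) (i.1 * d')).det := by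
    rw [up, Matrix.det_fin_two_of]
    simpa using mul_pos hA hB
  rw [← mob_Wm, ← mob_mul _ _ (by rw [hdet]; exact hmz) (by rw [Wm_det]; norm_num) hz, key,
    mob_mul _ _ (by rw [hg0.det]; norm_num) hup hz, k_inv g hg0 (mob_im_pos _ hup hz)]
  rfl

lemma low_W {m : ℕ} {j : Σ _ : ℕ, ℕ} (hj : j ∈ hl m) {z : ℂ} (hz : 0 < z.im) :
    4096 * k (mob (low m j) (-1 / (2 * z))) = 1 / k (mob (up (m / j.1 : ℕ) j.2 j.1) z) := by
  have hdet := (low_S hj).det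
  rw [mem_hl] at hj
  obtain ⟨⟨hi1, hm⟩, hi2, hi3⟩ := hj
  have hmz : (0 : ℤ) < m := by exact_mod_cast Nat.pos_of_ne_zero hm
  have hmul : (j.1 : ℤ) * ((m / j.1 : ℕ) : ℤ) = m := by exact_mod_cast Nat.mul_div_cancel' hi1
  have hup : 0 < (up (m / j.1 : ℕ) j.2 j.1).det := by
    rw [up, Matrix.det_fin_two_of, mul_zero, sub_zero, mul_comm, hmul]; exact hmz
  have key : low m j * Wm = Wm * up (m / j.1 : ℕ) j.2 j.1 := by
    ext r c
    fin_cases r <;> fin_cases c <;>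
      simp [low, Wm, up, Matrix.mul_apply, Fin.sum_univ_two, mul_comm]
  rw [← mob_Wm, ← mob_mul _ _ (by rw [hdet]; exact hmz) (by rw [Wm_det]; norm_num) hz, key,
    mob_mul _ _ (by rw [Wm_det]; norm_num) hup hz, mob_Wm, k_W (mob_im_pos _ hup hz)]
  field_simp

lemma qq_add (z w : ℂ) : qq (z + w) = qq z * qq w := by
  rw [qq, qq, qq, ← Complex.exp_add]; congr 1; ring

lemma qq_nat_mul (n : ℕ) (z : ℂ) : qq (n * z) = qq z ^ n := by
  rw [qq, qq, ← Complex.exp_nat_mul]; congr 1; ring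

lemma prim (d : ℕ) (hd : d ≠ 0) : IsPrimitiveRoot (qq (1 / d)) d := by
  have := Complex.isPrimitiveRoot_exp d hd
  rwa [qq, mul_one_div]

lemma low_sum {m : ℕ} (hm : 0 < m) (z : ℂ) :
    ∑ j ∈ hl m, 1 / qq (mob (up (m / j.1 : ℕ) j.2 j.1) z) = (1 / qq z) ^ m := by
  rw [hl, Finset.sum_sigma]
  rw [Finset.sum_eq_single 1]
  · simp [mob_up, qq_nat_mul]
  · intro a ha ha1
    rw [Finset.mem_filter, Nat.mem_divisors] at ha
    have hap : 0 < a := ha.2.pos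
    have : ∀ b ∈ Finset.range a, 1 / qq (mob (up (m / a : ℕ) b a) z) =
        (1 / qq ((m / a : ℕ) * z / a)) * (qq (1 / a))⁻¹ ^ b := by
      intro b _
      rw [mob_up, inv_pow, ← qq_nat_mul]
      rw [show (((m / a : ℕ) : ℤ) * z + (b : ℤ)) / ((a : ℤ) : ℂ) = ((m / a : ℕ) * z / a) + b * (1 / a) by
        simp only [Int.cast_natCast]; ring, qq_add, one_div, mul_inv, ← one_div (qq ((m / a : ℕ) * z / a))]
    rw [Finset.sum_congr rfl this, ← Finset.mul_sum, (prim a hap.ne').inv.geom_sum_eq_zero (by omega), mul_zero]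
  · intro h
    simp [hm.ne'] at h

lemma cusp0 {m : ℕ} (hm : 0 < m) :
    (fun z => 4096 * T m k (-1 / (2 * z)) - (1 / qq z) ^ m) =O[Iinf] fun _ => (1 : ℝ) := by
  classical
  have hmz : (0 : ℤ) < m := by exact_mod_cast hm
  set p : (Σ _ : ℕ, ℕ) → Prop := fun i => ∃ j ∈ hl m, Rel (rep m i) (low m j) with hp
  have h1 : (fun z => ∑ i ∈ (hs m).filter (fun i => ¬ p i), 4096 * k (mob (rep m i) (-1 / (2 * z))))
      =O[Iinf] fun _ => (1 : ℝ) := by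
    refine IsBigO.fun_sum fun i hi => ?_
    rw [Finset.mem_filter] at hi
    exact (bad_bdd hi.1 hi.2).const_mul_left _
  have h2 : (fun z => ∑ j ∈ hl m, (1 / k (mob (up (m / j.1 : ℕ) j.2 j.1) z) -
      1 / qq (mob (up (m / j.1 : ℕ) j.2 j.1) z))) =O[Iinf] fun _ => (1 : ℝ) := by
    refine IsBigO.fun_sum fun j hj => ?_
    rw [mem_hl] at hj
    have hjp := hj.2.1.pos
    have : 0 < m / j.1 := Nat.div_pos (Nat.le_of_dvd hm hj.1.1) hjp
    exact h_O.comp_tendsto (mob_up_tendsto (j.2 : ℤ) (by exact_mod_cast this) (by exact_mod_cast hjp))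
  refine (h1.add h2).congr' ?_ EventuallyEq.rfl
  filter_upwards [ev_im 0] with z hz
  have hWz := W_im_pos hz
  have e1 : ∑ i ∈ (hs m).filter p, 4096 * k (mob (rep m i) (-1 / (2 * z))) =
      ∑ j ∈ hl m, 4096 * k (mob (low m j) (-1 / (2 * z))) := by
    refine sum_rel ((hs m).filter p) (hl m) (rep m) (low m)
      (fun M => 4096 * k (mob M (-1 / (2 * z)))) ?_ ?_ ?_ ?_ ?_
    · intro i hi j hj h
      rw [Finset.mem_filter] at hi
      rw [phi_inv k_inv' (by rw [rep_det hi.1]; exact hmz) h hWz]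
    · intro i hi
      rw [Finset.mem_filter] at hi
      exact hi.2
    · intro j hj
      obtain ⟨i, hi, hr⟩ := reduce hm (low_S hj)
      exact ⟨i, Finset.mem_filter.mpr ⟨hi, j, hj, hr.symm⟩, hr.symm⟩
    · intro i hi j hj h
      rw [Finset.mem_filter] at hi hj
      exact rep_inj hi.1 hj.1 h
    · intro i hi j hj h
      exact low_inj hi hj h
  rw [T, Finset.mul_sum, ← Finset.sum_filter_add_sum_filter_not (hs m) p, e1,
    Finset.sum_congr rfl (fun j hj => low_W hj hz), Finset.sum_sub_distrib, low_sum hm]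
  ring

end Conway

namespace Conway
open Complex Filter Topology Asymptotics

lemma bdd_of_O {f : ℂ → ℂ} (h : f =O[Iinf] fun _ => (1 : ℝ)) :
    ∃ B Y : ℝ, ∀ z : ℂ, Y < z.im → ‖f z‖ ≤ B := by
  obtain ⟨B, hB⟩ := h.bound
  obtain ⟨Y, -, hY⟩ := Iinf_ev hB
  exact ⟨B, Y, fun z hz => by simpa using hY z hz⟩

lemma liouville_lim (G : ℂ → ℂ) (hd : ∀ z : ℂ, 0 < z.im → DifferentiableAt ℂ G z)
    (hinv : ∀ g : Mat, IsG0 g → ∀ z : ℂ, 0 < z.im → G (mob g z) = G z) {c : ℂ}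
    (h1 : Tendsto G Iinf (𝓝 c)) (h2 : (fun z => G (-1 / (2 * z))) =O[Iinf] fun _ => (1 : ℝ)) :
    ∀ z : ℂ, 0 < z.im → G z = c := by
  obtain ⟨B1, Y1, hb1⟩ := bdd_of_O (h1.isBigO_one ℝ)
  obtain ⟨B2, Y2, hb2⟩ := bdd_of_O h2
  obtain ⟨c', hc'⟩ := liouville G (fun z hz => (hd z hz).differentiableWithinAt) hinv (max B1 B2)
    (max Y1 Y2) (fun z hz => (hb1 z ((le_max_left _ _).trans_lt hz)).trans (le_max_left _ _))
    (fun z _ hz => (hb2 z ((le_max_right _ _).trans_lt hz)).trans (le_max_right _ _))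
  have : Tendsto G Iinf (𝓝 c') := by
    refine tendsto_const_nhds.congr' ?_
    filter_upwards [ev_im 0] with z hz using (hc' z hz).symm
  have := tendsto_nhds_unique h1 this
  rw [this]
  exact hc'

lemma T_diff {f : ℂ → ℂ} (hf : ∀ z : ℂ, 0 < z.im → DifferentiableAt ℂ f z) {m : ℕ} (hm : 0 < m)
    {z : ℂ} (hz : 0 < z.im) : DifferentiableAt ℂ (T m f) z := by
  refine DifferentiableAt.fun_sum fun i hi => ?_
  have hdet : 0 < (rep m i).det := by rw [rep_det hi]; exact_mod_cast hm
  have h1 : DifferentiableAt ℂ (mob (rep m i)) z := by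
    have := mob_denom_ne _ hdet hz
    refine DifferentiableAt.div ?_ ?_ this <;> fun_prop
  exact (hf _ (mob_im_pos _ hdet hz)).comp z h1

lemma T_two (f : ℂ → ℂ) (z : ℂ) : T 2 f z = f (z / 2) + f ((z + 1) / 2) := by
  have : hs 2 = {⟨1, 0⟩, ⟨1, 1⟩} := by decide
  rw [T, this, Finset.sum_pair (by simp)]
  simp [mob, rep]

lemma qq_half : qq (1 / 2) = -1 := by
  rw [qq, show 2 * (Real.pi : ℂ) * I * (1 / 2) = Real.pi * I by ring, Complex.exp_pi_mul_I]

lemma qq_one : qq 1 = 1 := by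
  rw [qq, mul_one, Complex.exp_two_pi_mul_I]

lemma D_add_one (z : ℂ) : D (z + 1) = D z := by
  rw [D_eq, D_eq, qq_add, qq_one, mul_one]

lemma jacobi {z : ℂ} (hz : 0 < z.im) :
    1 / k (z / 2) + 1 / k ((z + 1) / 2) + 48 + 4096 * k z = 0 := by
  have hhd : ∀ z : ℂ, 0 < z.im → DifferentiableAt ℂ (fun z => 1 / k z) z := fun z hz =>
    (differentiableAt_const _).div (k_diffAt hz) (k_ne hz)
  have hhi : ∀ g : Mat, IsG0 g → ∀ z : ℂ, 0 < z.im → 1 / k (mob g z) = 1 / k z :=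
    fun g hg z hz => by rw [k_inv g hg hz]
  have := liouville_lim (fun z => T 2 (fun z => 1 / k z) z + 48 + 4096 * k z) (c := 0) ?_ ?_ ?_ ?_ z hz
  · rw [T_two] at this; exact this
  · intro z hz
    exact ((T_diff hhd (by norm_num) hz).add_const _).add ((k_diffAt hz).const_mul _)
  · intro g hg z hz
    rw [T_inv hhi (by norm_num) g hg hz, k_inv g hg hz]
  · have h1 := h_tend.comp (mob_up_tendsto (a := 1) (d := 2) 0 (by norm_num) (by norm_num))
    have h2 := h_tend.comp (mob_up_tendsto (a := 1) (d := 2) 1 (by norm_num) (by norm_num))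
    have h3 := ((h1.add h2).add_const 48).add (k_tend_zero.const_mul 4096)
    rw [show (-24 + -24 + 48 + 4096 * 0 : ℂ) = 0 by norm_num] at h3
    refine h3.congr fun z => ?_
    simp only [T_two, Function.comp, mob_up]
    push_cast
    rw [show (1 * z + 0) / 2 = z / 2 by ring, show (1 * z + 1) / 2 = (z + 1) / 2 by ring,
      show (z + 1) / 2 = z / 2 + 1 / 2 by ring, qq_add, qq_half]
    field_simp
    ring
  · have h1 := (k_O.comp_tendsto (mob_up_tendsto (a := 2) (d := 1) 0 (by norm_num) (by norm_num))).const_mul_left 4096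
    have h2 := h_O.comp_tendsto (mob_up_tendsto (a := 2) (d := 2) (-1) (by norm_num) (by norm_num))
    have h3 := isBigO_const_const (48 : ℂ) (one_ne_zero (α := ℝ)) Iinf
    refine (((h1.add h2).add h3).add h_O).congr' ?_ EventuallyEq.rfl
    filter_upwards [ev_im 0] with z hz
    have hz0 : z ≠ 0 := by rintro rfl; simp at hz
    have hz2 : 0 < (z + -1 / 2).im := by
      have : ((-1 : ℂ) / 2).im = 0 := by simp
      simp [this, hz]
    simp only [T_two, Function.comp, mob_up]
    push_cast
    rw [show (2 * z + 0) / 1 = 2 * z by ring, show (2 * z + -1) / 2 = z + -1 / 2 by ring]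
    have e1 : -1 / (2 * z) / 2 = -1 / (2 * (2 * z)) := by field_simp
    have e2 : (-1 / (2 * z) + 1) / 2 = mob !![1, 0; 2, 1] (z + -1 / 2) := by
      simp [mob]
      have : 2 * (z + -1 / 2) + 1 ≠ 0 := by
        rw [show 2 * (z + -1 / 2) + 1 = 2 * z by ring]; simpa using hz0
      field_simp
      ring_nf
    have e3 : qq (-1 / 2) = -1 := by
      have : qq (1 / 2 + -1 / 2) = qq (1 / 2) * qq (-1 / 2) := qq_add _ _
      rw [show (1 / 2 + -1 / 2 : ℂ) = 0 by ring, qq_half] at this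
      simp [qq] at this
      rw [qq]
      linear_combination this
    rw [e1, e2, k_W hz, k_W (by rw [im_two_mul]; linarith), k_inv _ ⟨by simp [Matrix.det_fin_two], by simp⟩ hz2,
      qq_add, e3]
    have := k_ne hz
    have := qq_ne z
    field_simp
    ring

lemma fR_eq (z : ℂ) : fR z = 4096 * k z + 24 := by
  rw [fR, k, D, D]; ring

lemma fNS_eq {z : ℂ} (hz : 0 < z.im) : (fNS z - ftNS z) / 2 = 2048 * k z := by
  have hz2 : 0 < (z / 2).im := by
    rw [show z / 2 = mob (up 1 0 2) z by rw [mob_up]; push_cast; ring, mob_up_im]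
    norm_num; exact hz
  have hz3 : 0 < ((z + 1) / 2).im := by
    rw [show (z + 1) / 2 = mob (up 1 1 2) z by rw [mob_up]; push_cast; ring, mob_up_im]
    norm_num; exact hz
  have hz4 : 0 < (2 * z).im := by rw [im_two_mul]; linarith
  have h3 := D_three hz
  have hj := jacobi hz
  have e1 : fNS z = -(1 / k ((z + 1) / 2)) - 24 := by
    rw [fNS, k, show 2 * ((z + 1) / 2) = z + 1 by ring, D_add_one]
    have : _root_.eta z ^ 48 = D z ^ 2 := by rw [D]; ring
    rw [this]
    rw [← D, ← D]
    have h1 := D_ne hz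
    have : D z ^ 2 / (D (z / 2) * D (2 * z)) = - (D ((z + 1) / 2) / D z) := by
      rw [div_eq_iff (mul_ne_zero (D_ne hz2) (D_ne hz4)), ← neg_div, div_mul_eq_mul_div, eq_div_iff h1]
      linear_combination h3
    rw [this, one_div_div]
  have e2 : ftNS z = 1 / k (z / 2) + 24 := by
    rw [ftNS, k, show 2 * (z / 2) = z by ring, one_div_div, D, D]
  rw [e1, e2]
  linear_combination -(1/2 : ℂ) * hj

end Conway

namespace Conway
open Complex Filter Topology Asymptotics

noncomputable def ex (u : ℕ → ℂ) : ℕ → ℂ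
  | 0 => 1
  | n + 1 => (1 / ((n : ℂ) + 1)) * ∑ j : Fin (n + 1), u j * ex u (n - j)
termination_by n => n
decreasing_by omega

lemma ex_zero (u : ℕ → ℂ) : ex u 0 = 1 := by rw [ex]

lemma ex_succ (u : ℕ → ℂ) (n : ℕ) :
    ex u (n + 1) = (1 / ((n : ℂ) + 1)) * ∑ j ∈ Finset.range (n + 1), u j * ex u (n - j) := by
  rw [ex, Finset.sum_range (fun j => u j * ex u (n - j))]

lemma cast_ne (n : ℕ) : (n : ℂ) + 1 ≠ 0 := Nat.cast_add_one_ne_zero n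

lemma ex_succ' (u : ℕ → ℂ) (n : ℕ) :
    ex u (n + 1) * ((n : ℂ) + 1) = ∑ p ∈ Finset.HasAntidiagonal.antidiagonal n, u p.1 * ex u p.2 := by
  rw [ex_succ, Finset.Nat.sum_antidiagonal_eq_sum_range_succ (fun i j => u i * ex u j)]
  have := cast_ne n
  field_simp

lemma ex_ode (u : ℕ → ℂ) : PowerSeries.derivative ℂ (PowerSeries.mk (ex u)) =
    PowerSeries.mk u * PowerSeries.mk (ex u) := by
  ext n
  rw [PowerSeries.coeff_derivative, PowerSeries.coeff_mul]
  simp only [PowerSeries.coeff_mk]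
  exact ex_succ' u n

lemma ex_unique (u : ℕ → ℂ) (F : PowerSeries ℂ) (h0 : PowerSeries.coeff 0 F = 1)
    (h : PowerSeries.derivative ℂ F = PowerSeries.mk u * F) (n : ℕ) : PowerSeries.coeff n F = ex u n := by
  induction n using Nat.strong_induction_on with
  | _ n ih =>
    rcases n with _ | n
    · rw [h0, ex_zero]
    · have := congrArg (PowerSeries.coeff n) h
      rw [PowerSeries.coeff_derivative, PowerSeries.coeff_mul] at this
      simp only [PowerSeries.coeff_mk] at this
      rw [Finset.sum_congr rfl (g := fun p : ℕ × ℕ => u p.1 * ex u p.2), ← ex_succ' u n] at this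
      · exact mul_right_cancel₀ (cast_ne n) this
      · intro p hp
        rw [ih p.2 (by have := Finset.HasAntidiagonal.mem_antidiagonal.mp hp; omega)]

lemma ex_twist (e : ℕ → ℂ) (x : ℂ) (n : ℕ) :
    ex (fun j => -(x ^ (j + 1) + e j)) (n + 1) =
      ex (fun j => -e j) (n + 1) - x * ex (fun j => -e j) n := by
  set E := PowerSeries.mk (ex fun j => -e j) with hE
  set S : PowerSeries ℂ := PowerSeries.mk (fun j => x ^ (j + 1)) with hS
  have hS1 : S * (1 - PowerSeries.C x * PowerSeries.X) = PowerSeries.C x := by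
    ext n
    rw [mul_sub, mul_one, ← mul_assoc, map_sub]
    rcases n with _ | n
    · simp [hS]
    · rw [PowerSeries.coeff_succ_mul_X, mul_comm S, PowerSeries.coeff_C_mul]
      simp only [hS, PowerSeries.coeff_mk, PowerSeries.coeff_C]
      simp
      ring
  have hdE := ex_ode (fun j => -e j)
  rw [← hE] at hdE
  have h := ex_unique (fun j => -(x ^ (j + 1) + e j)) ((1 - PowerSeries.C x * PowerSeries.X) * E) ?_ ?_ (n + 1)
  · rw [← h, sub_mul, one_mul, mul_assoc, map_sub, PowerSeries.coeff_C_mul, PowerSeries.coeff_succ_X_mul]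
    simp [hE]
  · simp [hE, ex_zero]
  · have e1 : PowerSeries.mk (fun j => -(x ^ (j + 1) + e j)) = -S + PowerSeries.mk (fun j => -e j) := by
      ext n; simp [hS]; ring
    rw [e1, Derivation.leibniz, hdE, map_sub, Derivation.leibniz]
    simp
    linear_combination E * hS1

lemma ex_congr {u v : ℕ → ℂ} (h : ∀ j, u j = v j) (n : ℕ) : ex u n = ex v n := by
  rw [funext h]

lemma ex_tend_O {u : ℕ → ℂ → ℂ} (h : ∀ j, u j =O[Iinf] fun _ => (1 : ℝ)) (n : ℕ) :
    (fun z => ex (fun j => u j z) n) =O[Iinf] fun _ => (1 : ℝ) := by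
  induction n using Nat.strong_induction_on with
  | _ n ih =>
    rcases n with _ | n
    · simp only [ex_zero]
      exact isBigO_const_const _ one_ne_zero _
    · simp only [ex_succ]
      refine IsBigO.const_mul_left (IsBigO.fun_sum fun j hj => ?_) _
      have := (h j).mul (ih (n - j) (by omega))
      simpa using this

lemma ex_diff {u : ℕ → ℂ → ℂ} {z : ℂ} (h : ∀ j, DifferentiableAt ℂ (u j) z) (n : ℕ) :
    DifferentiableAt ℂ (fun z => ex (fun j => u j z) n) z := by
  induction n using Nat.strong_induction_on with
  | _ n ih =>
    rcases n with _ | n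
    · simp only [ex_zero]
      exact differentiableAt_const _
    · simp only [ex_succ]
      refine DifferentiableAt.const_mul (DifferentiableAt.fun_sum fun j hj => ?_) _
      exact (h j).mul (ih (n - j) (by omega))

lemma ex_lim {u : ℕ → ℂ → ℂ} {c : ℕ → ℂ}
    (h : ∀ j, Tendsto (fun z => u j z / qq z) Iinf (𝓝 ((j + 1) * c j))) (n : ℕ) :
    Tendsto (fun z => ex (fun j => u j z) (n + 1) / qq z) Iinf (𝓝 (c n)) := by
  induction n using Nat.strong_induction_on with
  | _ n ih =>
    have hq : Tendsto qq Iinf (𝓝 0) := qq_tendsto.mono_right nhdsWithin_le_nhds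
    have h0 : ∀ i < n, Tendsto (fun z => ex (fun j => u j z) (i + 1)) Iinf (𝓝 0) := by
      intro i hi
      have := (ih i hi).mul hq
      rw [mul_zero] at this
      exact this.congr fun z => div_mul_cancel₀ _ (qq_ne z)
    have h1 : ∀ j ∈ Finset.range (n + 1), Tendsto (fun z => u j z / qq z * ex (fun j => u j z) (n - j)) Iinf
        (𝓝 (if j = n then (n + 1) * c n else 0)) := by
      intro j hj
      rw [Finset.mem_range] at hj
      split_ifs with hjn
      · subst hjn
        simpa [ex_zero] using h j
      · obtain ⟨i, hi⟩ : ∃ i, n - j = i + 1 := ⟨n - j - 1, by omega⟩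
        rw [hi]
        have := (h j).mul (h0 i (by omega))
        simpa using this
    have h2 := (tendsto_finsetSum _ h1).const_mul (1 / ((n : ℂ) + 1))
    rw [Finset.sum_ite_eq' (Finset.range (n + 1)) n, if_pos (by simp), ← mul_assoc,
      one_div_mul_cancel (cast_ne n), one_mul] at h2
    refine h2.congr fun z => ?_
    rw [ex_succ, mul_div_assoc, Finset.sum_div]
    congr 1
    refine Finset.sum_congr rfl fun j _ => ?_
    ring

/-- q-expansions -/
lemma qexp_lim {c : ℕ → ℂ} {F : ℂ → ℂ}
    (h : ∀ z : ℂ, 0 < z.im → HasSum (fun n : ℕ => c n * qq z ^ n) (F z)) :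
    Tendsto (fun z => (F z - c 0) / qq z) Iinf (𝓝 (c 1)) := by
  have hI : 0 < I.im := by simp
  have hs := (h I hI).summable.norm
  have hs2 : Summable (fun n : ℕ => ‖c (n + 2)‖ * ‖qq I‖ ^ n) := by
    have := ((summable_nat_add_iff 2).mpr hs).mul_right (‖qq I‖ ^ 2)⁻¹
    refine this.congr fun n => ?_
    have hne : ‖qq I‖ ≠ 0 := norm_ne_zero_iff.mpr (qq_ne I)
    rw [norm_mul, norm_pow, pow_add]
    field_simp
  set K := ∑' n : ℕ, ‖c (n + 2)‖ * ‖qq I‖ ^ n with hK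
  have hq : Tendsto qq Iinf (𝓝 0) := qq_tendsto.mono_right nhdsWithin_le_nhds
  rw [tendsto_iff_norm_sub_tendsto_zero]
  have hlim : Tendsto (fun z => ‖qq z‖ * K) Iinf (𝓝 0) := by
    have := (hq.norm).mul_const K
    simpa using this
  refine squeeze_zero' (Eventually.of_forall fun _ => norm_nonneg _) ?_ hlim
  filter_upwards [ev_im 1] with z hz
  have hz0 : 0 < z.im := by linarith
  have hle : ‖qq z‖ ≤ ‖qq I‖ := by
    rw [norm_qq, norm_qq]
    apply Real.exp_le_exp.mpr
    have := Real.pi_pos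
    simp
    nlinarith
  have h2 := (hasSum_nat_add_iff' 2).mpr (h z hz0)
  have h3 : HasSum (fun n : ℕ => qq z * (c (n + 2) * qq z ^ n)) ((F z - c 0) / qq z - c 1) := by
    have := h2.mul_left (1 / qq z)
    have hne := qq_ne z
    have e1 : (fun n : ℕ => qq z * (c (n + 2) * qq z ^ n)) =
        fun n : ℕ => 1 / qq z * (c (n + 2) * qq z ^ (n + 2)) := by
      ext n
      field_simp
      ring
    have e2 : (F z - c 0) / qq z - c 1 = 1 / qq z * (F z - ∑ i ∈ Finset.range 2, c i * qq z ^ i) := by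
      simp only [Finset.sum_range_succ, Finset.sum_range_zero]
      field_simp
      ring
    rw [e1, e2]
    exact this
  have hb : ∀ n : ℕ, ‖qq z * (c (n + 2) * qq z ^ n)‖ ≤ ‖qq z‖ * (‖c (n + 2)‖ * ‖qq I‖ ^ n) := by
    intro n
    rw [norm_mul, norm_mul, norm_pow]
    gcongr
  rw [← h3.tsum_eq, ← tsum_mul_left]
  exact tsum_of_norm_bounded (hs2.mul_left _).hasSum hb |>.trans_eq rfl

end Conway

namespace Conway
open Complex Filter Topology Asymptotics

def IsB (b : ℕ → ℂ) : Prop := ∀ z : ℂ, 0 < z.im → HasSum (fun n : ℕ => b n * qq z ^ n) (k z)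

lemma qexp_zero {c : ℕ → ℂ} {F : ℂ → ℂ}
    (h : ∀ z : ℂ, 0 < z.im → HasSum (fun n : ℕ => c n * qq z ^ n) (F z)) :
    Tendsto F Iinf (𝓝 (c 0)) := by
  have hq : Tendsto qq Iinf (𝓝 0) := qq_tendsto.mono_right nhdsWithin_le_nhds
  have h1 := ((qexp_lim h).mul hq).add_const (c 0)
  rw [mul_zero, zero_add] at h1
  refine h1.congr fun z => ?_
  rw [div_mul_cancel₀ _ (qq_ne z)]; ring

lemma IsB.zero {b : ℕ → ℂ} (hb : IsB b) : b 0 = 0 :=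
  tendsto_nhds_unique (qexp_zero hb) k_tend_zero

lemma IsB.one {b : ℕ → ℂ} (hb : IsB b) : b 1 = 1 := by
  have := qexp_lim hb
  rw [hb.zero] at this
  simp only [sub_zero] at this
  exact tendsto_nhds_unique this k_tend_one

noncomputable def V (d : ℕ) (z : ℂ) : ℂ := ∑ β ∈ Finset.range d, k ((z + β) / d)

lemma root_sum {d : ℕ} (hd : 0 < d) (n : ℕ) :
    ∑ β ∈ Finset.range d, (qq (1 / d) ^ n) ^ β = if d ∣ n then (d : ℂ) else 0 := by
  split_ifs with h
  · have : qq (1 / d) ^ n = 1 := ((prim d hd.ne').pow_eq_one_iff_dvd n).mpr h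
    simp only [this, one_pow, Finset.sum_const, Finset.card_range, nsmul_eq_mul, mul_one]
  · have h1 : qq (1 / d) ^ n ≠ 1 := fun h' => h (((prim d hd.ne').pow_eq_one_iff_dvd n).mp h')
    rw [geom_sum_eq h1, ← pow_mul, mul_comm n d, pow_mul, (prim d hd.ne').pow_eq_one, one_pow, sub_self, zero_div]

lemma div_im {d : ℕ} (hd : 0 < d) (β : ℕ) {z : ℂ} (hz : 0 < z.im) : 0 < ((z + β) / d).im := by
  have : ((z + β) / d) = mob (up 1 β d) z := by rw [mob_up]; push_cast; ring
  rw [this, mob_up_im]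
  have : (0:ℝ) < d := by exact_mod_cast hd
  push_cast
  positivity

lemma V_exp {b : ℕ → ℂ} (hb : IsB b) {d : ℕ} (hd : 0 < d) {z : ℂ} (hz : 0 < z.im) :
    HasSum (fun r : ℕ => d * b (d * r) * qq z ^ r) (V d z) := by
  have h1 : HasSum (fun n : ℕ => ∑ β ∈ Finset.range d, b n * qq ((z + β) / d) ^ n) (V d z) :=
    hasSum_sum fun β _ => hb _ (div_im hd β hz)
  have hd0 : (d : ℂ) ≠ 0 := by exact_mod_cast hd.ne'
  have h2 : ∀ n : ℕ, ∑ β ∈ Finset.range d, b n * qq ((z + β) / d) ^ n =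
      if d ∣ n then d * b n * qq (z / d) ^ n else 0 := by
    intro n
    have : ∀ β ∈ Finset.range d, b n * qq ((z + β) / d) ^ n =
        b n * qq (z / d) ^ n * (qq (1 / d) ^ n) ^ β := by
      intro β _
      rw [show (z + β) / d = z / d + β * (1 / d) by ring, qq_add, qq_nat_mul]
      ring
    rw [Finset.sum_congr rfl this, ← Finset.mul_sum, root_sum hd]
    split_ifs <;> ring
  simp only [h2] at h1
  have hinj : Function.Injective (fun r : ℕ => d * r) := fun a b h => Nat.eq_of_mul_eq_mul_left hd h
  rw [← hinj.hasSum_iff] at h1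
  · refine h1.congr_fun ?_
    intro r
    simp only [Function.comp, dvd_mul_right, if_true]
    rw [pow_mul, ← qq_nat_mul d, show (d : ℂ) * (z / d) = z by field_simp]
  · intro x hx
    rw [if_neg]
    rintro ⟨r, rfl⟩
    exact hx ⟨r, rfl⟩

lemma T_V {m : ℕ} (z : ℂ) :
    T m k z = ∑ a ∈ m.divisors.filter Odd, V (m / a) (a * z) := by
  rw [T, hs, Finset.sum_sigma]
  refine Finset.sum_congr rfl fun a ha => ?_
  refine Finset.sum_congr rfl fun β hβ => ?_
  have : rep m ⟨a, β⟩ = up a β (m / a : ℕ) := rfl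
  rw [this, mob_up]
  simp only [Int.cast_natCast]

lemma T_lim {b : ℕ → ℂ} (hb : IsB b) {m : ℕ} (hm : 0 < m) :
    Tendsto (fun z => T m k z / qq z) Iinf (𝓝 (m * b m)) := by
  have hq : Tendsto qq Iinf (𝓝 0) := qq_tendsto.mono_right nhdsWithin_le_nhds
  have h1 : ∀ a ∈ m.divisors.filter Odd, Tendsto (fun z => V (m / a) (a * z) / qq z) Iinf
      (𝓝 (if a = 1 then m * b m else 0)) := by
    intro a ha
    rw [Finset.mem_filter, Nat.mem_divisors] at ha
    have hap := ha.2.pos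
    have hd : 0 < m / a := Nat.div_pos (Nat.le_of_dvd hm ha.1.1) hap
    have h := qexp_lim (fun z hz => V_exp hb hd hz)
    simp only [mul_zero, hb.zero, sub_zero, mul_one] at h
    have h2 := h.comp (mob_up_tendsto (a := a) (d := 1) 0 (by exact_mod_cast hap) (by norm_num))
    have h3 := h2.mul (hq.pow (a - 1))
    split_ifs with h1
    · subst h1
      simp at h3 
      refine h3.congr fun z => ?_
      simp [mob_up]
    · have : a - 1 ≠ 0 := by omega
      rw [zero_pow this, mul_zero] at h3
      refine h3.congr fun z => ?_
      obtain ⟨c, rfl⟩ : ∃ c, a = c + 1 := ⟨a - 1, by omega⟩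
      simp only [Function.comp, mob_up]
      have := qq_ne z
      simp only [Int.cast_natCast, Int.cast_zero, add_zero, Int.cast_one, div_one]
      rw [qq_nat_mul]
      simp only [Nat.add_sub_cancel]
      field_simp
      ring
  have h2 := tendsto_finsetSum _ h1
  rw [Finset.sum_ite_eq', if_pos (by simp [hm.ne'])] at h2
  refine h2.congr fun z => ?_
  rw [T_V, Finset.sum_div]

noncomputable def uu (z : ℂ) (j : ℕ) : ℂ := -4096 * T (j + 1) k z

theorem main {b : ℕ → ℂ} (hb : IsB b) (n : ℕ) {z : ℂ} (hz : 0 < z.im) :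
    ex (uu z) (n + 1) = -4096 * b (n + 1) * k z := by
  have key := liouville_lim (fun z => ex (uu z) (n + 1) / k z) (c := -4096 * b (n + 1)) ?_ ?_ ?_ ?_ z hz
  · rw [← key, div_mul_cancel₀ _ (k_ne hz)]
  · intro z hz
    refine DifferentiableAt.div ?_ (k_diffAt hz) (k_ne hz)
    exact ex_diff (u := fun j z => uu z j)
      (fun j => (T_diff (fun z hz => k_diffAt hz) (Nat.succ_pos j) hz).const_mul _) (n + 1)
  · intro g hg z hz
    rw [k_inv g hg hz, ex_congr (fun j => ?_)]
    rw [uu, uu, T_inv k_inv' (Nat.succ_pos j) g hg hz]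
  · have h := ex_lim (u := fun j z => uu z j) (c := fun j => -4096 * b (j + 1)) (fun j => ?_) n
    · have h2 := h.div k_tend_one one_ne_zero
      rw [div_one] at h2
      refine h2.congr fun z => ?_
      exact div_div_div_cancel_right₀ (qq_ne z) _ _
    · have := (T_lim hb (Nat.succ_pos j)).const_mul (-4096)
      refine (this.congr fun z => ?_).trans (le_of_eq ?_)
      · rw [uu]; ring
      · congr 1; push_cast; ring
  · set e : ℕ → ℂ → ℂ := fun j z => 4096 * T (j + 1) k (-1 / (2 * z)) - (1 / qq z) ^ (j + 1) with he
    have heO : ∀ j, (fun z => - e j z) =O[Iinf] fun _ => (1 : ℝ) := fun j =>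
      (cusp0 (Nat.succ_pos j)).neg_left
    have h1 := ((ex_tend_O heO (n + 1)).mul k_O).const_mul_left 4096
    have h2 := ((ex_tend_O heO n).mul (k_tend_one.isBigO_one ℝ)).const_mul_left 4096
    have h3 := h1.sub h2
    simp only [mul_one] at h3
    refine h3.congr' ?_ EventuallyEq.rfl
    filter_upwards [ev_im 0] with z hz
    have e1 : ex (uu (-1 / (2 * z))) (n + 1) = ex (fun j => -((1 / qq z) ^ (j + 1) + e j z)) (n + 1) := by
      refine ex_congr (fun j => ?_) _
      rw [uu, he]; ring
    rw [e1, ex_twist, k_W hz]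
    have := k_ne hz
    have := qq_ne z
    field_simp

end Conway

namespace Conway
open Complex Filter Topology Asymptotics

lemma qq_surj {x : ℂ} (h0 : x ≠ 0) (h1 : ‖x‖ < 1) : ∃ z : ℂ, 0 < z.im ∧ qq z = x := by
  have hpi : (Real.pi : ℂ) ≠ 0 := by exact_mod_cast Real.pi_ne_zero
  have hq : qq (Complex.log x / (2 * Real.pi * I)) = x := by
    rw [qq, mul_div_cancel₀ _ (by simp [hpi]), Complex.exp_log h0]
  refine ⟨_, ?_, hq⟩
  by_contra h
  have h2 := norm_qq (Complex.log x / (2 * Real.pi * I))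
  rw [hq] at h2
  have h3 : 1 ≤ Real.exp (-2 * Real.pi * (Complex.log x / (2 * Real.pi * I)).im) := by
    apply Real.one_le_exp
    have := Real.pi_pos
    nlinarith
  linarith

lemma IsB.summ {b : ℕ → ℂ} (hb : IsB b) {x : ℂ} (h1 : ‖x‖ < 1) :
    Summable (fun n : ℕ => b n * x ^ n) := by
  by_cases h0 : x = 0
  · subst h0
    refine summable_of_ne_finset_zero (s := {0}) ?_
    intro n hn
    rw [zero_pow (by simpa using hn), mul_zero]
  · obtain ⟨z, hz, rfl⟩ := qq_surj h0 h1
    exact (hb z hz).summable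

lemma IsB.summ_norm {b : ℕ → ℂ} (hb : IsB b) {r : ℝ} (h0 : 0 ≤ r) (h1 : r < 1) :
    Summable (fun n : ℕ => ‖b n‖ * r ^ n) := by
  have := (hb.summ (x := (r : ℂ)) (by simpa [abs_of_nonneg h0] using h1)).norm
  simpa [abs_of_nonneg h0] using this

lemma coeff_bound {b : ℕ → ℂ} (hb : IsB b) {ρ : ℝ} (h0 : 0 < ρ) (h1 : ρ < 1) (n : ℕ) :
    ‖b n‖ ≤ Real.exp (24 / (1 - ρ)) / ρ ^ n := by
  set p := FormalMultilinearSeries.ofScalars ℂ b with hp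
  obtain ⟨r, hr, hr1⟩ := exists_between h1
  have hr0 : 0 < r := h0.trans hr
  have hrad : ENNReal.ofReal r ≤ p.radius := by
    refine p.le_radius_of_summable (r := r.toNNReal) ?_
    rw [Real.coe_toNNReal _ hr0.le]
    refine (hb.summ_norm hr0.le hr1).congr fun n => ?_
    rw [hp, FormalMultilinearSeries.ofScalars_norm]
  have hpos : 0 < ENNReal.ofReal r := ENNReal.ofReal_pos.mpr hr0
  have hf := (p.hasFPowerSeriesOnBall (hpos.trans_le hrad)).mono hpos hrad
  have hval : ∀ x, p.sum x = ∑' n, b n * x ^ n := by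
    intro x
    have := FormalMultilinearSeries.ofScalars_sum_eq (E := ℂ) b x
    simpa [FormalMultilinearSeries.ofScalarsSum] using this
  have hd : DiffContOnCl ℂ p.sum (Metric.ball 0 ρ) := by
    refine DifferentiableOn.diffContOnCl_ball (U := Metric.ball 0 r) ?_ (Metric.closedBall_subset_ball hr)
    have := hf.differentiableOn
    rwa [Metric.eball_ofReal] at this
  have key := norm_iteratedDeriv_le_of_forall_mem_sphere_norm_le n h0 hd
    (C := Real.exp (24 / (1 - ρ))) ?_
  · have h2 := hf.factorial_smul 1 n
    rw [← iteratedDeriv_eq_iteratedFDeriv] at h2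
    rw [← h2, hp, FormalMultilinearSeries.ofScalars_apply_eq] at key
    have hn : (0:ℝ) < n.factorial := by exact_mod_cast n.factorial_pos
    simp [nsmul_eq_mul] at key
    rw [mul_div_assoc] at key
    exact le_of_mul_le_mul_left key hn
  · intro x hx
    have hx' : ‖x‖ = ρ := by simpa using hx
    obtain ⟨z, hz, rfl⟩ := qq_surj (x := x) (by rintro rfl; simp at hx'; linarith) (by linarith)
    rw [hval, (hb z hz).tsum_eq, ← hx']
    exact k_bound hz

lemma growth {b : ℕ → ℂ} (hb : IsB b) (r d : ℕ) :
    ‖b (r * d)‖ ≤ Real.exp 24 * Real.exp 13 ^ (r + d) := by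
  by_cases hn : r * d = 0
  · rw [hn, hb.zero, norm_zero]; positivity
  set n := r * d with hnd
  have hn1 : (1:ℝ) ≤ n := by exact_mod_cast Nat.one_le_iff_ne_zero.mpr hn
  set s := Real.sqrt n with hs
  have hs1 : 1 ≤ s := Real.one_le_sqrt.mpr hn1
  have hs2 : s * s = n := Real.mul_self_sqrt (by linarith)
  have h := coeff_bound hb (ρ := s / (s + 1)) (by positivity) (by rw [div_lt_one] <;> linarith) n
  have e1 : 24 / (1 - s / (s + 1)) = 24 * s + 24 := by field_simp; ring
  rw [e1] at h
  have e2 : (1 + 1 / s) ^ n ≤ Real.exp s := by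
    calc (1 + 1 / s) ^ n ≤ (Real.exp (1 / s)) ^ n := by
          gcongr
          linarith [Real.add_one_le_exp (1 / s)]
      _ = Real.exp s := by
          rw [← Real.exp_nat_mul]
          congr 1
          rw [← hs2]; field_simp
  have e3 : Real.exp (24 * s + 24) / (s / (s + 1)) ^ n = Real.exp (24 * s + 24) * (1 + 1 / s) ^ n := by
    rw [div_eq_mul_inv, ← inv_pow]
    congr 2
    field_simp
  rw [e3] at h
  refine h.trans ((mul_le_mul_of_nonneg_left e2 (Real.exp_pos _).le).trans ?_)
  rw [← Real.exp_add, ← Real.exp_nat_mul, ← Real.exp_add, Real.exp_le_exp]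
  have h4 : (n : ℝ) = r * d := by rw [hnd]; push_cast; ring
  have h5 : 2 * s ≤ r + d := by
    have hr0 : (0:ℝ) ≤ r := by positivity
    have hd0 : (0:ℝ) ≤ d := by positivity
    nlinarith [sq_nonneg ((r:ℝ) - d)]
  push_cast
  linarith

end Conway

namespace Conway
open Complex Filter Topology Asymptotics

lemma ode {u : ℕ → ℂ} {ε : ℝ} (hε : 0 < ε)
    (hA : Summable fun n : ℕ => ‖u n / ((n : ℂ) + 1)‖ * ε ^ (n + 1))
    (hF : Summable fun n : ℕ => ‖ex u n‖ * ε ^ n) {p : ℂ} (hp : ‖p‖ < ε) :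
    ∑' n : ℕ, ex u n * p ^ n = exp (∑' n : ℕ, u n / ((n : ℂ) + 1) * p ^ (n + 1)) := by
  set A : ℂ → ℂ := fun x => ∑' n : ℕ, u n / ((n : ℂ) + 1) * x ^ (n + 1) with hAdef
  set F : ℂ → ℂ := fun x => ∑' n : ℕ, ex u n * x ^ n with hFdef
  have hU : IsOpen (Metric.ball (0:ℂ) ε) := Metric.isOpen_ball
  have dA : ∀ n : ℕ, DifferentiableOn ℂ (fun x : ℂ => u n / ((n : ℂ) + 1) * x ^ (n + 1)) (Metric.ball (0:ℂ) ε) := by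
    intro n; fun_prop
  have dF : ∀ n : ℕ, DifferentiableOn ℂ (fun x : ℂ => ex u n * x ^ n) (Metric.ball (0:ℂ) ε) := by
    intro n; fun_prop
  have bA : ∀ (n : ℕ) (w : ℂ), w ∈ Metric.ball (0:ℂ) ε → ‖u n / ((n : ℂ) + 1) * w ^ (n + 1)‖ ≤
      ‖u n / ((n : ℂ) + 1)‖ * ε ^ (n + 1) := by
    intro n w hw
    have hw' : ‖w‖ ≤ ε := by simpa using (Metric.mem_ball.mp hw).le
    rw [norm_mul, norm_pow]; gcongr
  have bF : ∀ (n : ℕ) (w : ℂ), w ∈ Metric.ball (0:ℂ) ε → ‖ex u n * w ^ n‖ ≤ ‖ex u n‖ * ε ^ n := by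
    intro n w hw
    have hw' : ‖w‖ ≤ ε := by simpa using (Metric.mem_ball.mp hw).le
    rw [norm_mul, norm_pow]; gcongr
  have diffA : DifferentiableOn ℂ A (Metric.ball 0 ε) := differentiableOn_tsum_of_summable_norm hA dA hU bA
  have diffF : DifferentiableOn ℂ F (Metric.ball 0 ε) := differentiableOn_tsum_of_summable_norm hF dF hU bF
  have derivs : ∀ x ∈ Metric.ball (0:ℂ) ε, deriv F x = deriv A x * F x := by
    intro x hx
    have h1 := hasSum_deriv_of_summable_norm hA dA hU bA hx
    have h2 := hasSum_deriv_of_summable_norm hF dF hU bF hx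
    have e1 : ∀ n : ℕ, deriv (fun x : ℂ => u n / ((n : ℂ) + 1) * x ^ (n + 1)) x = u n * x ^ n := by
      intro n
      rw [deriv_const_mul_field, deriv_pow_field]
      have := cast_ne n
      push_cast
      field_simp
    have e2 : ∀ n : ℕ, deriv (fun x : ℂ => ex u n * x ^ n) x = ex u n * (n * x ^ (n - 1)) := by
      intro n
      rw [deriv_const_mul_field, deriv_pow_field]
    simp only [e1] at h1
    simp only [e2] at h2
    have h3 : HasSum (fun n : ℕ => ex u n * x ^ n) (F x) :=
      (Summable.of_norm (hF.of_nonneg_of_le (fun _ => norm_nonneg _) (fun n => bF n x hx))).hasSum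
    have h4 := (hasSum_nat_add_iff' 1).mpr h2
    simp only [Finset.sum_range_one, Nat.cast_zero, zero_mul, mul_zero, sub_zero, Nat.add_sub_cancel] at h4
    have h5 := tsum_mul_tsum_eq_tsum_sum_antidiagonal_of_summable_norm h1.summable.norm h3.summable.norm
    rw [h1.tsum_eq, h3.tsum_eq] at h5
    change deriv F x = deriv A x * F x
    rw [h5, ← h4.tsum_eq]
    refine tsum_congr fun n => ?_
    push_cast
    rw [← mul_assoc, ex_succ', Finset.sum_mul]
    refine Finset.sum_congr rfl fun y hy => ?_
    rw [← Finset.HasAntidiagonal.mem_antidiagonal.mp hy, pow_add]; ring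
  have hconn : IsPreconnected (Metric.ball (0:ℂ) ε) := (convex_ball 0 ε).isPreconnected
  have hp' : p ∈ Metric.ball (0:ℂ) ε := by simpa using hp
  have h0' : (0:ℂ) ∈ Metric.ball (0:ℂ) ε := by simpa using hε
  have key := IsOpen.is_const_of_deriv_eq_zero (𝕜 := ℂ) (f := fun x => F x * exp (-A x)) hU hconn
    (diffF.mul diffA.neg.cexp) ?_ hp' h0'
  · have hF0 : F 0 = 1 := by
      rw [hFdef]
      simp only
      rw [tsum_eq_single 0 (fun n hn => by rw [zero_pow hn, mul_zero]), ex_zero]; simp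
    have hA0 : A 0 = 0 := by
      simp [hAdef]
    simp only [hF0, hA0, neg_zero, exp_zero, one_mul] at key
    change F p = exp (A p)
    rw [exp_neg] at key
    have := exp_ne_zero (A p)
    field_simp at key
    exact key
  · intro x hx
    have a1 := (diffA.differentiableAt (hU.mem_nhds hx)).hasDerivAt
    have a2 := (diffF.differentiableAt (hU.mem_nhds hx)).hasDerivAt
    have := (a2.mul a1.neg.cexp).deriv
    simp only [Pi.zero_apply]
    refine Eq.trans this ?_
    rw [derivs x hx]
    simp only [Pi.neg_apply]
    ring

lemma hasSum_logs {x : ℂ} (h : ‖x‖ < 1) :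
    HasSum (fun i : ℕ => (2 : ℂ) * (1 / (2 * i + 1)) * x ^ (2 * i + 1)) (log (1 + x) - log (1 - x)) := by
  set term := fun n : ℕ => -1 * ((-x) ^ (n + 1) / ((n : ℂ) + 1)) + x ^ (n + 1) / (n + 1)
  have h_term_eq_goal :
      term ∘ (2 * ·) = fun k : ℕ => (2:ℂ) * (1 / (2 * k + 1)) * x ^ (2 * k + 1) := by
    ext n
    dsimp only [term, (· ∘ ·)]
    rw [Odd.neg_pow (⟨n, rfl⟩ : Odd (2 * n + 1)) x]
    push_cast
    ring_nf
  rw [← h_term_eq_goal, (mul_right_injective₀ (two_ne_zero' ℕ)).hasSum_iff]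
  · have h₁ := (hasSum_taylorSeries_neg_log' (z := -x) (by rwa [norm_neg])).mul_left (-1)
    have h2 := h₁.add (hasSum_taylorSeries_neg_log' h)
    have e : log (1 + x) - log (1 - x) = -1 * -log (1 - -x) + -log (1 - x) := by
      rw [sub_neg_eq_add]; ring
    rw [e]
    exact h2
  · intro m hm
    rw [Set.mem_range, not_exists] at hm
    have hm' : Even (m + 1) := by
      rcases Nat.even_or_odd m with ⟨c, hc⟩ | ho
      · exact absurd (by omega) (hm c)
      · exact ho.add_one
    dsimp [term]
    rw [Even.neg_pow hm', neg_one_mul, neg_add_cancel]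

noncomputable def g (b : ℕ → ℂ) (p q : ℂ) (x : (ℕ × ℕ) × ℕ) : ℂ :=
  -4096 / (2 * (x.2 : ℂ) + 1) * b (x.1.2 * (x.1.1 + 1)) * (p ^ (x.1.1 + 1) * q ^ x.1.2) ^ (2 * x.2 + 1)

lemma g_summ {b : ℕ → ℂ} (hb : IsB b) {p q : ℂ} (hp : ‖p‖ ≤ Real.exp (-18)) (hq : ‖q‖ ≤ Real.exp (-18)) :
    Summable (g b p q) := by
  have s1 : Summable (fun n : ℕ => Real.exp (-5) ^ n) :=
    summable_geometric_of_lt_one (Real.exp_pos _).le (by rw [Real.exp_lt_one_iff]; norm_num)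
  have s2 : Summable (fun n : ℕ => Real.exp (-18) ^ n) :=
    summable_geometric_of_lt_one (Real.exp_pos _).le (by rw [Real.exp_lt_one_iff]; norm_num)
  have s3 := (s1.mul_of_nonneg s1 (fun n => by positivity) (fun n => by positivity)).mul_of_nonneg s2
    (fun n => by positivity) (fun n => by positivity)
  refine Summable.of_norm_bounded (s3.mul_left (4096 * Real.exp 24 * Real.exp (-5))) ?_
  rintro ⟨⟨e, r⟩, i⟩
  simp only [g, norm_mul, norm_pow, norm_div, norm_neg]
  have hi : 1 ≤ ‖(2 * (i:ℂ) + 1)‖ := by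
    have : (2 * (i:ℂ) + 1) = ((2 * i + 1 : ℕ) : ℂ) := by push_cast; ring
    rw [this, norm_natCast]; push_cast; linarith [(Nat.cast_nonneg i : (0:ℝ) ≤ i)]
  have h1 : ‖(4096:ℂ)‖ / ‖(2 * (i:ℂ) + 1)‖ ≤ 4096 := by
    rw [div_le_iff₀ (by linarith)]
    norm_num
    linarith
  have h2 := growth hb r (e + 1)
  have hε1 : Real.exp (-18) ≤ 1 := by rw [Real.exp_le_one_iff]; norm_num
  have h3 : (‖p‖ ^ (e + 1) * ‖q‖ ^ r) ^ (2 * i + 1) ≤ Real.exp (-18) ^ (e + 1 + i + r) := by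
    calc _ ≤ (Real.exp (-18) ^ (e + 1) * Real.exp (-18) ^ r) ^ (2 * i + 1) := by gcongr
      _ = Real.exp (-18) ^ ((e + 1 + r) * (2 * i + 1)) := by rw [← pow_add, ← pow_mul]
      _ ≤ _ := by
        apply pow_le_pow_of_le_one (Real.exp_pos _).le hε1
        nlinarith [Nat.zero_le (e * i), Nat.zero_le (r * i)]
  calc _ ≤ 4096 * (Real.exp 24 * Real.exp 13 ^ (r + (e + 1))) * Real.exp (-18) ^ (e + 1 + i + r) := by gcongr
    _ = _ := by
      have : Real.exp (-5) = Real.exp 13 * Real.exp (-18) := by rw [← Real.exp_add]; norm_num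
      rw [this]; ring

lemma order1 {b : ℕ → ℂ} {p q S : ℂ} (hp : ‖p‖ < 1) (hq : ‖q‖ < 1) (h : HasSum (g b p q) S) :
    HasSum (fun x : ℕ × ℕ => -(2048 * b (x.2 * (x.1 + 1))) *
      (log (1 + p ^ (x.1 + 1) * q ^ x.2) - log (1 - p ^ (x.1 + 1) * q ^ x.2))) S := by
  refine h.prod_fiberwise ?_
  rintro ⟨e, r⟩
  have hx : ‖p ^ (e + 1) * q ^ r‖ < 1 := by
    rw [norm_mul, norm_pow, norm_pow]
    exact mul_lt_one_of_nonneg_of_lt_one_left (by positivity) (pow_lt_one₀ (norm_nonneg _) hp (by omega))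
      (pow_le_one₀ (norm_nonneg _) hq.le)
  refine ((hasSum_logs hx).mul_left (-(2048 * b (r * (e + 1))))).congr_fun ?_
  intro i
  simp only [g]
  ring

lemma order2 {b : ℕ → ℂ} (hb : IsB b) {p τ S : ℂ} (hτ : 0 < τ.im) (h : HasSum (g b p (qq τ)) S) :
    HasSum (fun n : ℕ => uu τ n / ((n : ℂ) + 1) * p ^ (n + 1)) S := by
  let φ : (ℕ × ℕ) × ℕ ≃ (ℕ × ℕ) × ℕ :=
    ⟨fun x => ((x.1.1, x.2), x.1.2), fun x => ((x.1.1, x.2), x.1.2), fun x => rfl, fun x => rfl⟩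
  have h1 : HasSum (g b p (qq τ) ∘ φ) S := φ.hasSum_iff.mpr h
  set W : ℕ × ℕ → ℂ := fun x => -4096 / (((2 * x.2 + 1 : ℕ) : ℂ) * ((x.1 + 1 : ℕ) : ℂ)) *
      p ^ ((x.1 + 1) * (2 * x.2 + 1)) * V (x.1 + 1) ((2 * x.2 + 1 : ℕ) * τ) with hW
  have h2 : HasSum W S := by
    refine h1.prod_fiberwise ?_
    rintro ⟨e, i⟩
    have hz : 0 < (((2 * i + 1 : ℕ) : ℂ) * τ).im := by
      rw [← Complex.ofReal_natCast, Complex.im_ofReal_mul]; positivity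
    refine ((V_exp hb (Nat.succ_pos e) hz).mul_left (-4096 / (((2 * i + 1 : ℕ) : ℂ) * ((e + 1 : ℕ) : ℂ)) *
      p ^ ((e + 1) * (2 * i + 1)))).congr_fun ?_
    intro r
    have e1 : ((e:ℂ) + 1) ≠ 0 := cast_ne e
    have e2 : (2 * (i:ℂ) + 1) ≠ 0 := by exact_mod_cast (by omega : 2 * i + 1 ≠ 0)
    simp only [Function.comp, φ, Equiv.coe_fn_mk, g, qq_nat_mul, Nat.succ_eq_add_one]
    rw [mul_comm r (e + 1), mul_pow, ← pow_mul, ← pow_mul, ← pow_mul, mul_comm r (2 * i + 1)]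
    push_cast
    field_simp
  have h3 := h2.tsum_fiberwise (fun x : ℕ × ℕ => (x.1 + 1) * (2 * x.2 + 1) - 1)
  refine h3.congr_fun ?_
  intro n
  have hset : ((fun x : ℕ × ℕ => (x.1 + 1) * (2 * x.2 + 1) - 1) ⁻¹' {n}) =
      (((n + 1).divisors.filter Odd).image (fun a => ((n + 1) / a - 1, (a - 1) / 2)) : Finset (ℕ × ℕ)) := by
    ext ⟨e, i⟩
    simp only [Set.mem_preimage, Set.mem_singleton_iff, Finset.coe_image, Set.mem_image, Finset.mem_coe,
      Finset.mem_filter, Nat.mem_divisors, Prod.mk.injEq]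
    constructor
    · intro hh
      have : (e + 1) * (2 * i + 1) = n + 1 := by
        have : 0 < (e + 1) * (2 * i + 1) := by positivity
        omega
      refine ⟨2 * i + 1, ⟨⟨⟨e + 1, by rw [← this]; ring⟩, by omega⟩, ⟨i, rfl⟩⟩, ?_, by omega⟩
      rw [← this, Nat.mul_div_cancel _ (by omega)]; omega
    · rintro ⟨a, ⟨⟨⟨c, hc⟩, _⟩, ⟨j, rfl⟩⟩, h5, h6⟩
      rw [hc, Nat.mul_div_cancel_left _ (by omega)] at h5
      have hc0 : 0 < c := by
        rcases Nat.eq_zero_or_pos c with rfl | h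
        · omega
        · exact h
      have h7 : e + 1 = c := by omega
      have h8 : i = j := by omega
      rw [h7, h8, mul_comm c, ← hc]; rfl
  rw [hset, Finset.tsum_subtype', Finset.sum_image]
  · rw [uu, T_V, Finset.mul_sum, Finset.sum_div, Finset.sum_mul]
    refine Finset.sum_congr rfl fun a ha => ?_
    rw [Finset.mem_filter, Nat.mem_divisors] at ha
    obtain ⟨⟨⟨c, hc⟩, _⟩, ⟨j, rfl⟩⟩ := ha
    have hc0 : 0 < c := by
      rcases Nat.eq_zero_or_pos c with rfl | h
      · omega
      · exact h
    obtain ⟨c, rfl⟩ : ∃ c', c = c' + 1 := ⟨c - 1, by omega⟩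
    have hj : (2 * j + 1 - 1) / 2 = j := by omega
    simp only [hW, hc]
    rw [Nat.mul_div_cancel_left _ (by omega), hj, Nat.add_sub_cancel]
    have hn : ((n:ℂ) + 1) = ((2 * j + 1 : ℕ) : ℂ) * ((c + 1 : ℕ) : ℂ) := by exact_mod_cast hc
    rw [hn, mul_comm (c + 1) (2 * j + 1)]
    ring
  · intro a ha a' ha' hh
    simp only [Finset.coe_filter, Set.mem_ofPred_eq] at ha ha'
    obtain ⟨_, ⟨j, rfl⟩⟩ := ha
    obtain ⟨_, ⟨j', rfl⟩⟩ := ha'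
    simp only [Prod.mk.injEq] at hh
    omega

end Conway

namespace Conway
open Complex Filter Topology Asymptotics

lemma qq_small {z : ℂ} (hz : 3 < z.im) : ‖qq z‖ < Real.exp (-18) := by
  rw [norm_qq, Real.exp_lt_exp]
  nlinarith [Real.pi_gt_three]

lemma expsum {b : ℕ → ℂ} (hb : IsB b) {σ τ : ℂ} (hσ : 3 < σ.im) (hτ : 3 < τ.im) :
    ∃ S, HasSum (g b (qq σ) (qq τ)) S ∧ exp S = 1 - 4096 * k σ * k τ := by
  have hσ0 : 0 < σ.im := by linarith
  have hτ0 : 0 < τ.im := by linarith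
  have h1 := (g_summ hb (qq_small hσ).le (qq_small hτ).le).hasSum
  refine ⟨_, h1, ?_⟩
  have hε : 0 < Real.exp (-18) := Real.exp_pos _
  have h2 := order2 hb hτ0 h1
  have h3 := (g_summ hb (p := (Real.exp (-18) : ℝ)) (by rw [norm_real, Real.norm_of_nonneg hε.le])
    (qq_small hτ).le).hasSum
  have h4 := (order2 hb hτ0 h3).summable.norm
  have h5 : Summable (fun n : ℕ => ‖ex (uu τ) n‖ * Real.exp (-18) ^ n) := by
    rw [← summable_nat_add_iff 1]
    have h6 := (summable_nat_add_iff 1).mpr (hb.summ_norm hε.le (by rw [Real.exp_lt_one_iff]; norm_num))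
    refine (h6.mul_left (4096 * ‖k τ‖)).congr fun n => ?_
    rw [main hb n hτ0, norm_mul, norm_mul, norm_neg]
    norm_num
    ring
  have h7 := ode hε (u := uu τ) (h4.congr fun n => ?_) h5 (qq_small hσ)
  · rw [h2.tsum_eq] at h7
    rw [← h7]
    have h8 : HasSum (fun n : ℕ => ex (uu τ) n * qq σ ^ n) (1 - 4096 * k σ * k τ) := by
      have h9 := (hasSum_nat_add_iff' 1).mpr (hb σ hσ0)
      rw [← hasSum_nat_add_iff' 1]
      simp only [Finset.sum_range_one, hb.zero, zero_mul, sub_zero] at h9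
      have e : 1 - 4096 * k σ * k τ - ∑ i ∈ Finset.range 1, ex (uu τ) i * qq σ ^ i = (-4096 * k τ) * k σ := by
        rw [Finset.sum_range_one, ex_zero]; ring
      rw [e]
      refine (h9.mul_left (-4096 * k τ)).congr_fun fun n => ?_
      rw [main hb n hτ0]; ring
    exact h8.tsum_eq
  · rw [norm_mul, norm_pow, norm_real, Real.norm_of_nonneg hε.le]

lemma prod1 {b : ℕ → ℂ} (hb : IsB b) {C : ℕ → ℤ} (hC : ∀ n, (C n : ℂ) = 2048 * b n)
    {σ τ : ℂ} (hσ : 3 < σ.im) (hτ : 3 < τ.im) :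
    HasProd (fun x : ℕ × ℕ => (1 - qq σ ^ (x.1 + 1) * qq τ ^ x.2) ^ C (x.2 * (x.1 + 1)) *
      (1 + qq σ ^ (x.1 + 1) * qq τ ^ x.2) ^ (-C (x.2 * (x.1 + 1)))) (1 - 4096 * k σ * k τ) := by
  obtain ⟨S, hS, hS2⟩ := expsum hb hσ hτ
  have hp : ‖qq σ‖ < 1 := norm_qq_lt (by linarith)
  have hq : ‖qq τ‖ < 1 := norm_qq_lt (by linarith)
  have h := (order1 hp hq hS).cexp
  rw [hS2] at h
  convert h using 1
  funext ⟨e, r⟩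
  have hx : ‖qq σ ^ (e + 1) * qq τ ^ r‖ < 1 := by
    rw [norm_mul, norm_pow, norm_pow]
    exact mul_lt_one_of_nonneg_of_lt_one_left (by positivity) (pow_lt_one₀ (norm_nonneg _) hp (by omega))
      (pow_le_one₀ (norm_nonneg _) hq.le)
  simp only [Function.comp]
  generalize qq σ ^ (e + 1) * qq τ ^ r = x at hx
  have n1 : 1 + x ≠ 0 := by
    intro h0
    rw [eq_neg_of_add_eq_zero_right h0] at hx; simp at hx
  have n2 : 1 - x ≠ 0 := by
    intro h0
    rw [← sub_eq_zero.mp h0] at hx; simp at hx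
  rw [← hC, neg_mul, mul_sub, neg_sub, sub_eq_add_neg (_ * _) (_ * _), exp_add, ← neg_mul, exp_int_mul, exp_log n2]
  congr 1
  rw [← Int.cast_neg, exp_int_mul, exp_log n1]

lemma M_ne {z : ℂ} (hz : 0 < z.im) : M (qq z) ≠ 0 := by
  intro h
  have := k_eqM hz
  rw [h] at this
  exact k_ne hz (by rw [this]; simp)

lemma prod2 {z : ℂ} (hz : 0 < z.im) :
    HasProd (fun x : ℕ × ℕ => if x.2 = 0 then (1 + qq z ^ (x.1 + 1)) ^ (-24 : ℤ) else 1)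
      ((M (qq z) ^ 24)⁻¹) := by
  have hinj : Function.Injective (fun e : ℕ => (e, 0) : ℕ → ℕ × ℕ) := fun a b h => by simpa using h
  rw [← hinj.hasProd_iff]
  · have h1 : HasProd (fun n : ℕ => 1 + qq z ^ (n + 1)) (M (qq z)) := (mult_M (norm_qq_lt hz)).hasProd
    have h2 : HasProd (fun n : ℕ => (1 + qq z ^ (n + 1)) ^ 24) (M (qq z) ^ 24) := by
      unfold HasProd at h1 ⊢
      refine (h1.pow 24).congr fun s => ?_
      rw [Finset.prod_pow]
    have h3 : HasProd (fun n : ℕ => ((1 + qq z ^ (n + 1)) ^ 24)⁻¹) ((M (qq z) ^ 24)⁻¹) := by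
      unfold HasProd at h2 ⊢
      refine (h2.inv₀ (pow_ne_zero _ (M_ne hz))).congr fun s => ?_
      rw [Finset.prod_inv_distrib]
    convert h3 using 1
    funext n
    simp only [Function.comp, if_true]
    rw [zpow_neg]
    rfl
  · rintro ⟨e, r⟩ hx
    rw [if_neg]
    rintro h
    simp only at h
    subst h
    exact hx ⟨e, rfl⟩

lemma coeff_zero {c : ℕ → ℂ} (h : ∀ z : ℂ, 0 < z.im → HasSum (fun n : ℕ => c n * qq z ^ n) 0) (n : ℕ) :
    c n = 0 := by
  induction n generalizing c with
  | zero => exact tendsto_nhds_unique (qexp_zero (F := fun _ => 0) h) tendsto_const_nhds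
  | succ n ih =>
    have h0 : c 0 = 0 := tendsto_nhds_unique (qexp_zero (F := fun _ => 0) h) tendsto_const_nhds
    refine ih (c := fun n => c (n + 1)) fun z hz => ?_
    have h1 := (hasSum_nat_add_iff' 1).mpr (h z hz)
    simp only [Finset.sum_range_one, h0, zero_mul, sub_zero] at h1
    have h2 := h1.mul_right (qq z)⁻¹
    rw [zero_mul] at h2
    refine h2.congr_fun fun n => ?_
    have := qq_ne z
    rw [pow_succ]; field_simp

theorem final (C00 C01 : ℕ → ℤ)
    (h00 : ∀ τ : ℂ, 0 < τ.im →
      HasSum (fun n : ℕ => (C00 n : ℂ) * qq τ ^ n) ((fNS τ - ftNS τ) / 2))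
    (h01 : ∀ τ : ℂ, 0 < τ.im →
      HasSum (fun n : ℕ => (C01 n : ℂ) * qq τ ^ n) (-(fR τ + 24) / 2)) 
    (σ τ : ℂ) (hσ : 3 < σ.im) (hτ : 3 < τ.im) :
      HasProd (fun dr : ℕ × ℕ =>
        (1 - qq σ ^ (dr.1 + 1) * qq τ ^ dr.2) ^ C00 (dr.2 * (dr.1 + 1)) *
        (1 + qq σ ^ (dr.1 + 1) * qq τ ^ dr.2) ^ C01 (dr.2 * (dr.1 + 1)))
        (qq σ * (_root_.eta σ ^ 24 / _root_.eta (2 * σ) ^ 24 + 24 - fR τ)) := by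
  have hσ0 : 0 < σ.im := by linarith
  have hb : IsB (fun n => (C00 n : ℂ) / 2048) := by
    intro z hz
    have h := (h00 z hz).mul_left (1 / 2048)
    rw [fNS_eq hz] at h
    have e : 1 / 2048 * (2048 * k z) = k z := by ring
    rw [e] at h
    exact h.congr_fun fun n => by ring
  have hz0 : C00 0 = 0 := by
    have := hb.zero
    simpa using this
  have hc : ∀ n, (C01 n : ℂ) + C00 n + (if n = 0 then 24 else 0) = 0 := by
    refine coeff_zero (c := fun n => (C01 n : ℂ) + C00 n + (if n = 0 then 24 else 0)) fun z hz => ?_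
    have h1 := ((h01 z hz).add (h00 z hz)).add (hasSum_ite_eq (0:ℕ) (24:ℂ))
    rw [fNS_eq hz, fR_eq] at h1
    have e : -(4096 * k z + 24 + 24) / 2 + 2048 * k z + 24 = 0 := by ring
    rw [e] at h1
    refine h1.congr_fun fun n => ?_
    split_ifs with hn
    · subst hn; simp
    · ring
  have hc0 : C01 0 = -24 := by
    have := hc 0
    rw [hz0] at this
    simp only [Int.cast_zero, add_zero, if_true] at this
    have := eq_neg_of_add_eq_zero_left this
    exact_mod_cast this
  have hcn : ∀ n, n ≠ 0 → C01 n = -C00 n := by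
    intro n hn
    have := hc n
    rw [if_neg hn, add_zero] at this
    have := eq_neg_of_add_eq_zero_left this
    exact_mod_cast this
  have h1 := (prod1 hb (C := C00) (fun n => by ring) hσ hτ).mul (prod2 hσ0)
  have e : (1 - 4096 * k σ * k τ) * (M (qq σ) ^ 24)⁻¹ =
      qq σ * (_root_.eta σ ^ 24 / _root_.eta (2 * σ) ^ 24 + 24 - fR τ) := by
    have e1 : _root_.eta σ ^ 24 / _root_.eta (2 * σ) ^ 24 = 1 / k σ := by
      rw [k, D, D, one_div_div]
    rw [e1, fR_eq, k_eqM hσ0]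
    have := M_ne hσ0
    have := qq_ne σ
    field_simp
    ring
  rw [e] at h1
  refine h1.congr_fun ?_
  rintro ⟨d, r⟩
  simp only
  split_ifs with hr
  · subst hr
    simp [hz0, hc0]
  · rw [hcn _ (by positivity), mul_one]

end Conway

/-- the denominator identity of the Conway BKM superalgebra.
    Given the (unique) integer Fourier coefficients `C00`, `C01` of
    `F_{0,0} = (f_NS − f̃_NS)/2` and `F_{0,1} = −(f_R + 24)/2`, there is `Y > 0`
    such that for `Im σ, Im τ > Y` the product over `d ≥ 1`, `r ≥ 0` of
    `(1 − p^d q^r)^{C00(rd)} (1 + p^d q^r)^{C01(rd)}` converges (absolutely,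
    i.e. unconditionally) to `p · (η(σ)^24/η(2σ)^24 + 24 − f_R(τ))`. -/
theorem statement0 (C00 C01 : ℕ → ℤ)
    (h00 : ∀ τ : ℂ, 0 < τ.im →
      HasSum (fun n : ℕ => (C00 n : ℂ) * Complex.exp (2 * Real.pi * Complex.I * τ) ^ n)
        ((fNS τ - ftNS τ) / 2))
    (h01 : ∀ τ : ℂ, 0 < τ.im →
      HasSum (fun n : ℕ => (C01 n : ℂ) * Complex.exp (2 * Real.pi * Complex.I * τ) ^ n)
        (-(fR τ + 24) / 2)) :
    ∃ Y > (0 : ℝ), ∀ σ τ : ℂ, Y < σ.im → Y < τ.im →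
      HasProd (fun dr : ℕ × ℕ =>
        (1 - Complex.exp (2 * Real.pi * Complex.I * σ) ^ (dr.1 + 1) *
              Complex.exp (2 * Real.pi * Complex.I * τ) ^ dr.2) ^ C00 (dr.2 * (dr.1 + 1)) *
        (1 + Complex.exp (2 * Real.pi * Complex.I * σ) ^ (dr.1 + 1) *
              Complex.exp (2 * Real.pi * Complex.I * τ) ^ dr.2) ^ C01 (dr.2 * (dr.1 + 1)))
        (Complex.exp (2 * Real.pi * Complex.I * σ) *
          (eta σ ^ 24 / eta (2 * σ) ^ 24 + 24 - fR τ)) := by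
  exact ⟨3, by norm_num, fun σ τ hσ hτ => Conway.final C00 C01 h00 h01 σ τ hσ hτ⟩
end

section
/- There exists Y > 0 such that for all σ, τ in the upper half-plane with Im σ > Y and Im τ > Y, the infinite product converges absolutely and p^{-1} · ∏_{d=1}^∞ ∏_{r=0}^∞ (1 − p^d q^r)^{C_{0,0}(rd) + C_{0,1}(rd)} = 1/η(σ)^{24}. (This is the superdenominator identity of the Conway Borcherds–Kac–Moody superalgebra.) -/
open scoped Real

section helpers
open UpperHalfPlane Filter Topology MatrixGroups
open scoped ModularForm
noncomputable def EE (x : ℂ) : ℂ := ∏' n : ℕ, (1 - x ^ (n + 1))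

lemma EE_mult {x : ℂ} (hx : ‖x‖ < 1) : Multipliable fun n : ℕ ↦ 1 - x ^ (n + 1) :=
  ModularForm.multipliable_one_sub_pow hx

lemma eta_eq (τ : ℂ) : eta τ = ModularForm.eta τ := by
  unfold eta ModularForm.eta
  simp only [ModularForm.eta_q_eq_cexp]
  congr 1
  simp only [Function.Periodic.qParam]
  congr 1
  push_cast
  ring

lemma eta24 (τ : ℂ) : eta τ ^ 24 = Complex.exp (2 * π * Complex.I * τ) *
    EE (Complex.exp (2 * π * Complex.I * τ)) ^ 24 := by
  rw [eta_eq]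
  unfold ModularForm.eta EE
  simp only [ModularForm.eta_q_eq_pow, mul_pow]
  congr 1
  rw [Function.Periodic.qParam, ← Complex.exp_nat_mul]
  congr 1
  push_cast
  ring

lemma odd_mult {x : ℂ} (hx : ‖x‖ < 1) : Multipliable fun n : ℕ ↦ 1 - x ^ (2 * n + 1) := by
  apply multipliable_one_add_of_summable (f := fun n ↦ -x ^ (2 * n + 1))
  have := (summable_geometric_of_lt_one (norm_nonneg x) hx).comp_injective
    (i := fun n : ℕ => 2 * n + 1) (fun a b h => by simpa using h)
  simpa using! this

lemma norm_sq_lt {x : ℂ} (hx : ‖x‖ < 1) : ‖x ^ 2‖ < 1 := by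
  rw [norm_pow]; exact pow_lt_one₀ (norm_nonneg _) hx (by norm_num)

lemma EE_split {x : ℂ} (hx : ‖x‖ < 1) :
    EE x = (∏' n : ℕ, (1 - x ^ (2 * n + 1))) * EE (x ^ 2) := by
  unfold EE
  rw [← tprod_even_mul_odd (f := fun n : ℕ => 1 - x ^ (n + 1)) (odd_mult hx)]
  · congr 1
    apply tprod_congr; intro n
    rw [← pow_mul]; ring_nf
  · refine (EE_mult (norm_sq_lt hx)).congr ?_
    intro n
    rw [← pow_mul]; ring_nf

lemma EE_ident {x : ℂ} (hx : ‖x‖ < 1) : EE x * EE (-x) * EE (x ^ 4) = EE (x ^ 2) ^ 3 := by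
  have hn : ‖-x‖ < 1 := by simpa using hx
  rw [EE_split hx, EE_split hn, neg_sq]
  have h2 := EE_split (norm_sq_lt hx)
  have h3 : (∏' n : ℕ, (1 - x ^ (2 * n + 1))) * (∏' n : ℕ, (1 - (-x) ^ (2 * n + 1)))
      = ∏' n : ℕ, (1 - (x ^ 2) ^ (2 * n + 1)) := by
    rw [← (odd_mult hx).tprod_mul (odd_mult hn)]
    apply tprod_congr; intro n
    rw [Odd.neg_pow ⟨n, rfl⟩, ← pow_mul]; ring
  rw [← h3, show (x ^ 2) ^ 2 = x ^ 4 by ring] at h2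
  linear_combination (- EE (x ^ 2) ^ 2) * h2

lemma D_ne {τ : ℂ} (h : 0 < τ.im) : eta τ ^ 24 ≠ 0 := by
  rw [eta_eq]; exact pow_ne_zero _ (ModularForm.eta_ne_zero h)

lemma D_T (τ : ℂ) : eta (τ + 1) ^ 24 = eta τ ^ 24 := by
  rw [eta24, eta24, mul_add, mul_one, Complex.exp_periodic]

lemma csqrt_pow_24_eq' {z : ℂ} (hz : z ≠ 0) : Complex.sqrt z ^ 24 = z ^ 12 := by
  rw [sqrt_eq_exp hz, ← Complex.exp_nat_mul]
  ring_nf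
  rw [show (Complex.log z * 12) = (12 : ℕ) * Complex.log z by push_cast; ring,
    Complex.exp_nat_mul, Complex.exp_log hz]

lemma csqrt_I_pow_24' : Complex.sqrt Complex.I ^ 24 = 1 := by
  rw [csqrt_pow_24_eq' Complex.I_ne_zero, show 12 = 4 * 3 by norm_num, pow_mul,
    Complex.I_pow_four, one_pow]

lemma D_S {τ : ℂ} (h : 0 < τ.im) : eta (-1 / τ) ^ 24 = τ ^ 12 * eta τ ^ 24 := by
  have h0 : τ ≠ 0 := by rintro rfl; simp at h
  have := ModularForm.eta_comp_eq_csqrt_I_inv h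
  simp only [Function.comp, Pi.smul_apply, Pi.mul_apply, smul_eq_mul] at this
  rw [eta_eq, this, eta_eq, mul_pow, mul_pow, csqrt_pow_24_eq' h0, inv_pow,
    csqrt_I_pow_24']
  simp

lemma D_prod {τ : ℂ} (h : 0 < τ.im) :
    eta (τ / 2) ^ 24 * eta ((τ + 1) / 2) ^ 24 * eta (2 * τ) ^ 24 = - (eta τ ^ 24) ^ 3 := by
  set x := Complex.exp (π * Complex.I * τ) with hx
  have e1 : Complex.exp (2 * π * Complex.I * (τ / 2)) = x := by rw [hx]; congr 1; ring
  have e2 : Complex.exp (2 * π * Complex.I * ((τ + 1) / 2)) = -x := by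
    rw [show 2 * π * Complex.I * ((τ + 1) / 2) = π * Complex.I * τ + π * Complex.I by ring,
      Complex.exp_add, Complex.exp_pi_mul_I]; ring
  have e3 : Complex.exp (2 * π * Complex.I * (2 * τ)) = x ^ 4 := by
    rw [hx, ← Complex.exp_nat_mul]; congr 1; push_cast; ring
  have e4 : Complex.exp (2 * π * Complex.I * τ) = x ^ 2 := by
    rw [hx, ← Complex.exp_nat_mul]; congr 1; push_cast; ring
  have hn : ‖x‖ < 1 := by
    rw [hx, Complex.norm_exp]
    simp
    positivity
  rw [eta24, eta24, eta24, eta24, e1, e2, e3, e4]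
  have := EE_ident hn
  calc _ = - x ^ 6 * (EE x * EE (-x) * EE (x ^ 4)) ^ 24 := by ring
    _ = _ := by rw [this]; ring

lemma D_gamma {w : ℂ} (h : 0 < w.im) :
    eta ((w - 1) / (2 * w - 1)) ^ 24 = (2 * w - 1) ^ 12 * eta w ^ 24 := by
  have h1 : 0 < (w - 1).im := by simpa using h
  have n1 : w - 1 ≠ 0 := by intro e; rw [e] at h1; simp at h1
  have n2 : 2 * w - 1 ≠ 0 := by
    intro e
    have : (2 * w - 1).im = 2 * w.im := by simp
    rw [e] at this; simp at this; linarith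
  have hu : 0 < (-1 / (w - 1)).im := by
    rw [neg_div, one_div, Complex.neg_im, Complex.inv_im]
    have := Complex.normSq_pos.mpr n1
    rw [neg_div, neg_neg]; positivity
  have hv : 0 < (-1 / (w - 1) - 2).im := by simpa using hu
  have e : (w - 1) / (2 * w - 1) = -1 / (-1 / (w - 1) - 2) := by
    have : -1 / (w - 1) - 2 = - (2 * w - 1) / (w - 1) := by field_simp; ring
    rw [this]; field_simp
  rw [e, D_S hv, ← D_T (-1 / (w - 1) - 2), ← D_T, show -1 / (w - 1) - 2 + 1 + 1 = -1 / (w - 1) by ring,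
    D_S h1, ← D_T (w - 1), sub_add_cancel, ← mul_assoc, ← mul_pow]
  congr 1
  have : (-1 / (w - 1) - 2) * (w - 1) = -(2 * w - 1) := by field_simp; ring
  rw [this]; ring

noncomputable def GG (τ : ℂ) : ℂ :=
  eta (τ / 2) ^ 24 + eta ((τ + 1) / 2) ^ 24 + 2 ^ 12 * eta (2 * τ) ^ 24

lemma G_T (τ : ℂ) : GG (τ + 1) = GG τ := by
  unfold GG
  rw [show (τ + 1 + 1) / 2 = τ / 2 + 1 by ring, D_T, show 2 * (τ + 1) = 2 * τ + 1 + 1 by ring,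
    D_T, D_T]
  ring

lemma im_half {τ : ℂ} (h : 0 < τ.im) : 0 < (τ / 2).im := by
  simpa using h
lemma im_half' {τ : ℂ} (h : 0 < τ.im) : 0 < ((τ + 1) / 2).im := by
  simpa using h
lemma im_two {τ : ℂ} (h : 0 < τ.im) : 0 < (2 * τ).im := by
  simpa using h

lemma G_S {τ : ℂ} (h : 0 < τ.im) : GG (-1 / τ) = τ ^ 12 * GG τ := by
  have h0 : τ ≠ 0 := by rintro rfl; simp at h
  unfold GG
  have a1 : -1 / τ / 2 = -1 / (2 * τ) := by field_simp
  have a2 : (-1 / τ + 1) / 2 = ((τ + 1) / 2 - 1) / (2 * ((τ + 1) / 2) - 1) := by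
    rw [show 2 * ((τ + 1) / 2) - 1 = τ by ring]; field_simp; ring
  have a3 : 2 * (-1 / τ) = -1 / (τ / 2) := by field_simp
  rw [a1, a2, a3, D_S (im_two h), D_S (im_half h), D_gamma (im_half' h)]
  ring

noncomputable def GH (z : ℍ) : ℂ := GG z

lemma GH_T : (GH ∣[(12 : ℤ)] ModularGroup.T) = GH := by
  ext z
  have hd : denom ModularGroup.T z = 1 := by
    rw [ModularGroup.denom_apply]; simp [ModularGroup.T]
  rw [ModularForm.SL_slash_apply, modular_T_smul, hd]
  have : GG ((z : ℂ) + 1) = GG z := G_T z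
  simp [GH, add_comm (1 : ℂ), this]

lemma GH_S : (GH ∣[(12 : ℤ)] ModularGroup.S) = GH := by
  ext z
  suffices GG (-(↑z)⁻¹) * ((z : ℂ) ^ 12)⁻¹ = GG z by
    rw [ModularForm.SL_slash_apply, UpperHalfPlane.modular_S_smul, ModularGroup.denom_S]
    simpa [GH] using! this
  have h := G_S z.2
  rw [neg_div, one_div] at h
  have := z.ne_zero
  rw [UpperHalfPlane.coe] at *
  rw [h]
  field_simp

lemma EE_tendsto : Tendsto (fun τ : ℂ => eta τ ^ 24) (comap Complex.im atTop) (𝓝 0) := by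
  have h := ModularForm.discriminant_isZeroAtImInfty
  unfold IsZeroAtImInfty ZeroAtFilter atImInfty at h
  rw [Metric.tendsto_nhds] at h ⊢
  intro ε hε
  have := h ε hε
  rw [eventually_comap] at this ⊢
  filter_upwards [this, eventually_gt_atTop 0] with b hb h0 a ha
  have := hb ⟨a, by rw [ha]; exact h0⟩ ha
  simpa [ModularForm.discriminant, eta_eq] using this

lemma GH_zero : IsZeroAtImInfty GH := by
  unfold IsZeroAtImInfty ZeroAtFilter
  have t : ∀ g : ℍ → ℂ, (∀ z : ℍ, z.im / 2 ≤ (g z).im) →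
      Tendsto (fun z => eta (g z) ^ 24) atImInfty (𝓝 0) := by
    intro g hg
    refine EE_tendsto.comp ?_
    rw [tendsto_comap_iff]
    refine tendsto_atTop_mono hg ?_
    exact Tendsto.atTop_div_const (by norm_num) tendsto_comap
  have h := ((t (fun z => z / 2) (fun z => by simp)).add
    (t (fun z => (z + 1) / 2) (fun z => by simp))).add
    ((t (fun z => 2 * z) (fun z => by simp; linarith [z.im_pos])).const_mul (2 ^ 12 : ℂ))
  simpa [GH, GG] using! h

lemma eta_diff {τ : ℂ} (h : 0 < τ.im) : DifferentiableAt ℂ eta τ := by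
  rw [show eta = ModularForm.eta from funext eta_eq]
  exact ModularForm.differentiableAt_eta_of_mem_upperHalfPlaneSet h

noncomputable def GC : CuspForm 𝒮ℒ 12 where
  toFun := GH
  slash_action_eq' A hA := by
    obtain ⟨A, rfl⟩ := hA
    exact SlashInvariantForm.slash_action_generators_SL2Z GH_S GH_T A
  holo' := by
    rw [UpperHalfPlane.mdifferentiable_iff]
    refine .congr (f := GG) (fun z hz ↦ DifferentiableAt.differentiableWithinAt ?_) fun z hz ↦ ?_
    · unfold GG
      have h1 := (eta_diff (im_half hz)).comp z (f := fun z => z / 2) (by fun_prop)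
      have h2 := (eta_diff (im_half' hz)).comp z (f := fun z => (z + 1) / 2) (by fun_prop)
      have h3 := (eta_diff (im_two hz)).comp z (f := fun z => 2 * z) (by fun_prop)
      exact ((h1.pow 24).add (h2.pow 24)).add ((h3.pow 24).const_mul _)
    · simp [GH, ofComplex_apply_of_im_pos hz]
  zero_at_cusps' hc := by
    rw [Subgroup.IsArithmetic.isCusp_iff_isCusp_SL2Z] at hc
    rw [OnePoint.isZeroAt_iff_forall_SL2Z hc]
    intro γ _
    rw [SlashInvariantForm.slash_action_generators_SL2Z GH_S GH_T]
    exact GH_zero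

lemma exists_c : ∃ c : ℂ, ∀ τ : ℂ, 0 < τ.im → GG τ = c * eta τ ^ 24 := by
  obtain ⟨c, hc⟩ := CuspForm.exists_smul_discriminant_of_weight_eq_twelve GC
  refine ⟨c, fun τ h => ?_⟩
  have := DFunLike.congr_fun hc ⟨τ, h⟩
  rw [eta_eq]
  exact this.symm

/-- value at the order three point -/
lemma c_cube {c : ℂ} (hc : ∀ τ : ℂ, 0 < τ.im → GG τ = c * eta τ ^ 24) :
    (c / 3) ^ 3 = - 2 ^ 12 := by
  let t : ℂ := ⟨1 / 2, √3 / 2⟩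
  have ht : 0 < t.im := by simp [t]
  have ht2 : t ^ 2 = t - 1 := by
    have : √3 * √3 = 3 := Real.mul_self_sqrt (by norm_num)
    apply Complex.ext <;> simp [t, pow_two] <;> nlinarith
  have t0 : t ≠ 0 := by intro e; rw [e] at ht; simp at ht
  have ht3 : t ^ 3 = -1 := by linear_combination (t + 1) * ht2
  have ht12 : t ^ 12 = 1 := by
    rw [show t ^ 12 = (t ^ 3) ^ 4 by ring, ht3]; norm_num
  have h1 := D_S (im_two ht)
  rw [show -1 / (2 * t) = (t + 1) / 2 - 1 by
    field_simp; linear_combination -ht2, ← D_T, sub_add_cancel, mul_pow, ht12] at h1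
  have h2 := D_S (im_half ht)
  rw [show -1 / (t / 2) = 2 * t - 1 - 1 by
    field_simp; linear_combination -2 * ht2, ← D_T, sub_add_cancel, ← D_T, sub_add_cancel,
    div_pow, ht12] at h2
  have h3 := D_prod ht
  have h4 := hc t ht
  unfold GG at h4
  have hn := D_ne ht
  rw [h1, h2] at h4
  rw [h1, h2] at h3
  generalize eta (t / 2) ^ 24 = x at *
  generalize eta t ^ 24 = y at *
  have h5 : c / 3 = x / y := by field_simp; linear_combination -h4
  have h6 : x ^ 3 = - 2 ^ 12 * y ^ 3 := by linear_combination 2 ^ 12 * h3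
  rw [h5, div_pow, h6]; field_simp

lemma F_eq {c : ℂ} (hc : ∀ τ : ℂ, 0 < τ.im → GG τ = c * eta τ ^ 24) {τ : ℂ} (h : 0 < τ.im) :
    (fNS τ - ftNS τ) / 2 + -(fR τ + 24) / 2 = (- c - 96) / 2 := by
  have h1 := hc τ h
  have h2 := D_prod h
  unfold GG at h1
  unfold fNS ftNS fR
  rw [show eta τ ^ 48 = (eta τ ^ 24) ^ 2 by ring]
  have n1 := D_ne h
  have n2 := D_ne (im_half h)
  have n3 := D_ne (im_two h)
  generalize eta (τ / 2) ^ 24 = x at *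
  generalize eta ((τ + 1) / 2) ^ 24 = y at *
  generalize eta (2 * τ) ^ 24 = z at *
  generalize eta τ ^ 24 = d at *
  have h3 : d ^ 2 / (x * z) = - y / d := by field_simp; linear_combination h2
  have h4 : c = (x + y + 2 ^ 12 * z) / d := by field_simp; linear_combination -h1
  rw [h3, h4]; field_simp; ring

lemma coeff_const {a : ℕ → ℂ} {k : ℂ}
    (h : ∀ z : ℂ, z ≠ 0 → ‖z‖ < 1 → HasSum (fun n => a n * z ^ n) k) :
    a 0 = k ∧ ∀ n, n ≠ 0 → a n = 0 := by
  let f : ℂ → ℂ := fun z => if z = 0 then a 0 else k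
  let p := FormalMultilinearSeries.ofScalars ℂ a
  have hp : HasFPowerSeriesAt f p 0 := by
    rw [hasFPowerSeriesAt_iff]
    filter_upwards [Metric.ball_mem_nhds (0 : ℂ) one_pos] with z hz
    rw [mem_ball_zero_iff] at hz
    by_cases h0 : z = 0
    · subst h0
      have := hasSum_single (f := fun n => (0 : ℂ) ^ n • p.coeff n) 0
        (fun n hn => by simp [hn])
      simpa [f, p, FormalMultilinearSeries.coeff_ofScalars] using this
    · simpa [f, h0, p, FormalMultilinearSeries.coeff_ofScalars, mul_comm] using h z h0 hz
  have hk : a 0 = k := by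
    have h1 : Tendsto f (𝓝[≠] 0) (𝓝 (f 0)) := hp.continuousAt.tendsto.mono_left nhdsWithin_le_nhds
    have h2 : Tendsto f (𝓝[≠] 0) (𝓝 k) := by
      refine tendsto_const_nhds.congr' ?_
      filter_upwards [self_mem_nhdsWithin] with z hz
      simp only [f]; rw [if_neg (by simpa using hz)]
    have := tendsto_nhds_unique h1 h2
    simpa [f] using this
  refine ⟨hk, fun n hn => ?_⟩
  have hf : f = fun _ => k := by ext z; simp [f, hk]
  have h2 : HasFPowerSeriesAt f (constFormalMultilinearSeries ℂ ℂ k) 0 := by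
    rw [hf]; exact hasFPowerSeriesAt_const
  have := hp.eq_formalMultilinearSeries h2
  have h3 : p.coeff n = 0 := by
    rw [this, FormalMultilinearSeries.coeff, constFormalMultilinearSeries_apply_of_nonzero hn]; rfl
  simpa [p, FormalMultilinearSeries.coeff_ofScalars] using h3

lemma coeffs (C00 C01 : ℕ → ℤ)
    (h00 : ∀ τ : ℂ, 0 < τ.im →
      HasSum (fun n : ℕ => (C00 n : ℂ) * Complex.exp (2 * Real.pi * Complex.I * τ) ^ n)
        ((fNS τ - ftNS τ) / 2))
    (h01 : ∀ τ : ℂ, 0 < τ.im →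
      HasSum (fun n : ℕ => (C01 n : ℂ) * Complex.exp (2 * Real.pi * Complex.I * τ) ^ n)
        (-(fR τ + 24) / 2)) :
    C00 0 + C01 0 = -24 ∧ ∀ n, n ≠ 0 → C00 n + C01 n = 0 := by
  obtain ⟨c, hc⟩ := exists_c
  obtain ⟨k0, k1⟩ := coeff_const (a := fun n => ((C00 n + C01 n : ℤ) : ℂ)) (k := (-c - 96) / 2)
    (by
      intro z hz0 hz1
      let τ := Function.Periodic.invQParam 1 z
      have hτ : 0 < τ.im := Function.Periodic.im_invQParam_pos_of_norm_lt_one one_pos hz1 hz0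
      have hq : Complex.exp (2 * Real.pi * Complex.I * τ) = z := by
        have := Function.Periodic.qParam_right_inv (h := 1) one_ne_zero hz0
        simpa [Function.Periodic.qParam] using this
      have := (h00 τ hτ).add (h01 τ hτ)
      rw [F_eq hc hτ, hq] at this
      refine this.congr_fun ?_
      intro n; push_cast; ring)
  refine ⟨?_, fun n hn => by exact_mod_cast k1 n hn⟩
  have h3 := c_cube hc
  set N := C00 0 + C01 0
  have hcN : c = -96 - 2 * (N : ℂ) := by linear_combination 2 * k0
  rw [hcN] at h3
  have h4 : (96 + 2 * N) ^ 3 = 48 ^ 3 := by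
    have : ((96 + 2 * N : ℂ)) ^ 3 = 48 ^ 3 := by linear_combination -27 * h3
    exact_mod_cast this
  have := (Odd.strictMono_pow (n := 3) (R := ℤ) (by decide)).injective h4
  omega

end helpers

/-- the superdenominator identity of the Conway BKM superalgebra.
    With `C00`, `C01` the integer Fourier coefficients of `F_{0,0} = (f_NS − f̃_NS)/2`
    and `F_{0,1} = −(f_R + 24)/2`, there is `Y > 0` such that for `Im σ, Im τ > Y`
    the product over `d ≥ 1`, `r ≥ 0` of `(1 − p^d q^r)^{C00(rd) + C01(rd)}`
    converges (absolutely, i.e. unconditionally) to `p / η(σ)^24`. -/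
theorem statement1 (C00 C01 : ℕ → ℤ)
    (h00 : ∀ τ : ℂ, 0 < τ.im →
      HasSum (fun n : ℕ => (C00 n : ℂ) * Complex.exp (2 * Real.pi * Complex.I * τ) ^ n)
        ((fNS τ - ftNS τ) / 2))
    (h01 : ∀ τ : ℂ, 0 < τ.im →
      HasSum (fun n : ℕ => (C01 n : ℂ) * Complex.exp (2 * Real.pi * Complex.I * τ) ^ n)
        (-(fR τ + 24) / 2)) :
    ∃ Y > (0 : ℝ), ∀ σ τ : ℂ, Y < σ.im → Y < τ.im →
      HasProd (fun dr : ℕ × ℕ =>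
        (1 - Complex.exp (2 * Real.pi * Complex.I * σ) ^ (dr.1 + 1) *
              Complex.exp (2 * Real.pi * Complex.I * τ) ^ dr.2) ^
          (C00 (dr.2 * (dr.1 + 1)) + C01 (dr.2 * (dr.1 + 1))))
        (Complex.exp (2 * Real.pi * Complex.I * σ) * (1 / eta σ ^ 24)) := by
  obtain ⟨k0, k1⟩ := coeffs C00 C01 h00 h01
  refine ⟨1, one_pos, fun σ τ hσ hτ => ?_⟩
  have hσ0 : 0 < σ.im := by linarith
  have hp : ‖Complex.exp (2 * Real.pi * Complex.I * σ)‖ < 1 := by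
    rw [Complex.norm_exp]
    simp
    positivity
  rw [eta24]
  have hne := D_ne hσ0
  rw [eta24] at hne
  have hp0 := Complex.exp_ne_zero (2 * Real.pi * Complex.I * σ)
  generalize Complex.exp (2 * Real.pi * Complex.I * σ) = p at *
  generalize Complex.exp (2 * Real.pi * Complex.I * τ) = q at *
  have hE : EE p ^ 24 ≠ 0 := right_ne_zero_of_mul hne
  have hg : Function.Injective (fun d : ℕ => (d, 0) : ℕ → ℕ × ℕ) := fun a b h => by simpa using h
  rw [← hg.hasProd_iff]
  · have h1 : HasProd (fun n : ℕ => 1 - p ^ (n + 1)) (EE p) := (EE_mult hp).hasProd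
    have h2 : HasProd (fun n : ℕ => (1 - p ^ (n + 1)) ^ 24) (EE p ^ 24) := by
      unfold HasProd at h1 ⊢
      simp only [Finset.prod_pow]
      exact h1.pow 24
    have h3 := h2.inv₀ hE
    have e : p * (1 / (p * EE p ^ 24)) = (EE p ^ 24)⁻¹ := by field_simp
    rw [e]
    refine h3.congr_fun ?_
    intro n
    simp only [Function.comp, zero_mul, pow_zero, mul_one, k0]
    rw [zpow_neg]
    rfl
  · rintro ⟨d, r⟩ hdr
    have hr : r ≠ 0 := by
      rintro rfl
      exact hdr ⟨d, rfl⟩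
    rw [k1 _ (Nat.mul_ne_zero hr (Nat.succ_ne_zero d)), zpow_zero]
end
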